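/- arXiv:2411.05866 — 2 statements merged into one kernel-verified Lean document; each statement's English description precedes it below -/
import Mathlib

section
/- Suppose K^w, K^v ∈ C¹(𝒯) solve the kernel equations, and let (w̃, ṽ) be a C¹ solution of the plant with the backstepping control input U(t) = −κ w̃(L,t) + ∫₀^L K^w(L,ξ) w̃(ξ,t) dξ + ∫₀^L K^v(L,ξ) ṽ(ξ,t) dξ. Then the closed-loop system converges to zero in finite time: w̃(x,t) = 0 and ṽ(x,t) = 0 for all x ∈ [0,L] and all t ≥ t_f := L/λ₁ + L/λ₂. -/
open Set Real

/-- Boundary form of the divergence theorem on a rectangle for a divergence-free planar field. -/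
lemma boundary_integral_eq_zero_of_div_eq_zero {S T : ℝ} (hS : 0 ≤ S) (hT : 0 ≤ T)
    (P Q : ℝ × ℝ → ℝ)
    (hPc : ContinuousOn P (Icc 0 S ×ˢ Icc 0 T)) (hQc : ContinuousOn Q (Icc 0 S ×ˢ Icc 0 T))
    (hPd : ∀ s ∈ Ioo 0 S, ∀ θ ∈ Ioo 0 T, DifferentiableAt ℝ P (s, θ))
    (hQd : ∀ s ∈ Ioo 0 S, ∀ θ ∈ Ioo 0 T, DifferentiableAt ℝ Q (s, θ))
    (hdiv : ∀ s ∈ Ioo 0 S, ∀ θ ∈ Ioo 0 T,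
      deriv (fun z => P (z, θ)) s + deriv (fun z => Q (s, z)) θ = 0) :
    (((∫ s in (0:ℝ)..S, Q (s, T)) - ∫ s in (0:ℝ)..S, Q (s, 0))
      + ∫ θ in (0:ℝ)..T, P (S, θ)) - ∫ θ in (0:ℝ)..T, P (0, θ) = 0 := by
  classical
  let R : Set (ℝ × ℝ) := Ioo 0 S ×ˢ Ioo 0 T
  let P' : ℝ × ℝ → ℝ × ℝ →L[ℝ] ℝ := fun p => if p ∈ R then fderiv ℝ P p else 0
  let Q' : ℝ × ℝ → ℝ × ℝ →L[ℝ] ℝ := fun p => if p ∈ R then fderiv ℝ Q p else 0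
  have hzero : ∀ p, P' p (1, 0) + Q' p (0, 1) = 0 := by
    rintro ⟨s, θ⟩
    by_cases hp : (s, θ) ∈ R
    · have hP := (hPd s hp.1 θ hp.2).hasFDerivAt.comp_hasDerivAt s
        ((hasDerivAt_id s).prodMk (hasDerivAt_const s θ))
      have hQ := (hQd s hp.1 θ hp.2).hasFDerivAt.comp_hasDerivAt θ
        ((hasDerivAt_const θ s).prodMk (hasDerivAt_id θ))
      have h := hdiv s hp.1 θ hp.2
      simp only [P', Q', if_pos hp]
      rw [← hP.deriv, ← hQ.deriv]
      exact h
    · simp [P', Q', if_neg hp]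
  have key := MeasureTheory.integral2_divergence_prod_of_hasFDerivAt_off_countable
    P Q P' Q' 0 0 S T ∅ countable_empty
    (by rwa [uIcc_of_le hS, uIcc_of_le hT]) (by rwa [uIcc_of_le hS, uIcc_of_le hT])
    (by
      rw [min_eq_left hS, max_eq_right hS, min_eq_left hT, max_eq_right hT]
      rintro ⟨s, θ⟩ ⟨hp, -⟩
      simp only [P', if_pos (show (s, θ) ∈ R from hp)]
      exact (hPd s hp.1 θ hp.2).hasFDerivAt)
    (by
      rw [min_eq_left hS, max_eq_right hS, min_eq_left hT, max_eq_right hT]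
      rintro ⟨s, θ⟩ ⟨hp, -⟩
      simp only [Q', if_pos (show (s, θ) ∈ R from hp)]
      exact (hQd s hp.1 θ hp.2).hasFDerivAt)
    (by simp only [hzero]; exact MeasureTheory.integrableOn_zero)
  simp only [hzero, intervalIntegral.integral_zero] at key
  exact key.symm

/-- Chain rule along a planar curve, expressed through the partial derivatives. -/
lemma hasDerivAt_comp_curve {u : ℝ → ℝ → ℝ} {X Y : ℝ → ℝ} {X' Y' s x y : ℝ}
    (hu : DifferentiableAt ℝ (fun p : ℝ × ℝ => u p.1 p.2) (x, y))
    (hX : HasDerivAt X X' s) (hY : HasDerivAt Y Y' s) (hx : X s = x) (hy : Y s = y) :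
    HasDerivAt (fun z => u (X z) (Y z))
      (X' * deriv (fun z => u z y) x + Y' * deriv (fun z => u x z) y) s := by
  subst hx hy
  have h1 := hu.hasFDerivAt.comp_hasDerivAt (X s)
    ((hasDerivAt_id (X s)).prodMk (hasDerivAt_const (X s) (Y s)))
  have h2 := hu.hasFDerivAt.comp_hasDerivAt (Y s)
    ((hasDerivAt_const (Y s) (X s)).prodMk (hasDerivAt_id (Y s)))
  have h3 := hu.hasFDerivAt.comp_hasDerivAt s (hX.prodMk hY)
  have e1 : deriv (fun z => u z (Y s)) (X s) = _ := h1.deriv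
  have e2 : deriv (fun z => u (X s) z) (Y s) = _ := h2.deriv
  have hv : ((X', Y') : ℝ × ℝ) = X' • ((1, 0) : ℝ × ℝ) + Y' • ((0, 1) : ℝ × ℝ) := by
    ext <;> simp
  rw [e1, e2]
  rw [hv, map_add, map_smul, map_smul] at h3
  exact h3

/-- Integration of the transport equation `∂ₜu + a ∂ₓu = f` along a characteristic. -/
lemma transport_along_characteristic {L a x₀ t₀ S : ℝ} {u f : ℝ → ℝ → ℝ}
    (hS : 0 ≤ S) (ht₀ : 0 ≤ t₀)
    (hu : ContDiffOn ℝ 1 (fun p : ℝ × ℝ => u p.1 p.2) (Icc 0 L ×ˢ Ici 0))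
    (hpde : ∀ x ∈ Ioo (0:ℝ) L, ∀ t ∈ Ioi (0:ℝ),
      deriv (fun s => u x s) t + a * deriv (fun y => u y t) x = f x t)
    (hf : ContinuousOn (fun p : ℝ × ℝ => f p.1 p.2) (Icc 0 L ×ˢ Ici 0))
    (hIcc : ∀ s ∈ Icc 0 S, x₀ + a * s ∈ Icc 0 L)
    (hIoo : ∀ s ∈ Ioo 0 S, x₀ + a * s ∈ Ioo 0 L) :
    u (x₀ + a * S) (t₀ + S) - u x₀ t₀ = ∫ s in (0:ℝ)..S, f (x₀ + a * s) (t₀ + s) := by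
  have hmaps : MapsTo (fun s => (x₀ + a * s, t₀ + s)) (Icc 0 S) (Icc 0 L ×ˢ Ici 0) :=
    fun s hs => ⟨hIcc s hs, add_nonneg ht₀ hs.1⟩
  have hγ : ContinuousOn (fun s : ℝ => (x₀ + a * s, t₀ + s)) (Icc 0 S) := by fun_prop
  have hfc := hf.comp hγ hmaps
  have h := intervalIntegral.integral_eq_sub_of_hasDerivAt_of_le hS
    (f := fun s => u (x₀ + a * s) (t₀ + s)) (f' := fun s => f (x₀ + a * s) (t₀ + s))
    (hu.continuousOn.comp hγ hmaps) ?_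
    (ContinuousOn.intervalIntegrable (by rw [uIcc_of_le hS]; exact hfc))
  · simpa using h.symm
  · intro s hs
    have hx := hIoo s hs
    have ht : 0 < t₀ + s := add_pos_of_nonneg_of_pos ht₀ hs.1
    have hd : DifferentiableAt ℝ (fun p : ℝ × ℝ => u p.1 p.2) (x₀ + a * s, t₀ + s) :=
      (hu.contDiffAt (prod_mem_nhds (Icc_mem_nhds hx.1 hx.2) (Ici_mem_nhds ht))).differentiableAt
        (by simp)
    have hX : HasDerivAt (fun s => x₀ + a * s) a s := by
      simpa using ((hasDerivAt_id s).const_mul a).const_add x₀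
    have hT : HasDerivAt (fun s => t₀ + s) 1 s := (hasDerivAt_id s).const_add t₀
    refine (hasDerivAt_comp_curve hd hX hT rfl rfl).congr_deriv ?_
    rw [← hpde _ hx _ ht]
    ring

/-- The backstepping functional, transported along a left-going characteristic, balances the
in-domain coupling `c w`. -/
lemma integral_kernel_eq_neg_integral_coupling {L lam1 lam2 t₀ : ℝ}
    (hL : 0 < L) (h1 : 0 < lam1) (h2 : 0 < lam2) (ht₀ : 0 ≤ t₀) {c : ℝ → ℝ}
    {Kw Kv w v : ℝ → ℝ → ℝ}
    (hKw : ContDiffOn ℝ 1 (fun p : ℝ × ℝ => Kw p.1 p.2)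
      {p : ℝ × ℝ | 0 ≤ p.2 ∧ p.2 ≤ p.1 ∧ p.1 ≤ L})
    (hKv : ContDiffOn ℝ 1 (fun p : ℝ × ℝ => Kv p.1 p.2)
      {p : ℝ × ℝ | 0 ≤ p.2 ∧ p.2 ≤ p.1 ∧ p.1 ≤ L})
    (hker1 : ∀ x ξ : ℝ, 0 ≤ ξ → ξ ≤ x → x ≤ L →
      lam2 * deriv (fun y => Kw y ξ) x - lam1 * deriv (fun s => Kw x s) ξ = c ξ * Kv x ξ)
    (hker2 : ∀ x ξ : ℝ, 0 ≤ ξ → ξ ≤ x → x ≤ L →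
      deriv (fun y => Kv y ξ) x + deriv (fun s => Kv x s) ξ = 0)
    (hker3 : ∀ x ∈ Icc (0:ℝ) L, Kw x x = -c x / (lam1 + lam2))
    (hker4 : ∀ x ∈ Icc (0:ℝ) L, Kv x 0 = -Kw x 0)
    (hw : ContDiffOn ℝ 1 (fun p : ℝ × ℝ => w p.1 p.2) (Icc 0 L ×ˢ Ici 0))
    (hv : ContDiffOn ℝ 1 (fun p : ℝ × ℝ => v p.1 p.2) (Icc 0 L ×ˢ Ici 0))
    (hwpde : ∀ x ∈ Ioo (0:ℝ) L, ∀ t ∈ Ioi (0:ℝ),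
      deriv (fun s => w x s) t + lam1 * deriv (fun y => w y t) x = 0)
    (hvpde : ∀ x ∈ Ioo (0:ℝ) L, ∀ t ∈ Ioi (0:ℝ),
      deriv (fun s => v x s) t - lam2 * deriv (fun y => v y t) x = c x * w x t)
    (hbc0 : ∀ t : ℝ, 0 ≤ t → w 0 t = -(lam2 / lam1) * v 0 t) :
    (∫ ξ in (0:ℝ)..L, Kw L ξ * w ξ t₀ + Kv L ξ * v ξ t₀)
      = -∫ s in (0:ℝ)..L / lam2, c (L + -lam2 * s) * w (L + -lam2 * s) (t₀ + s) := by
  set S := L / lam2 with hSdef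
  have hS : 0 < S := div_pos hL h2
  have hSL : L + -lam2 * S = 0 := by rw [hSdef]; field_simp; ring
  have hX : ∀ s ∈ Icc 0 S, L + -lam2 * s ∈ Icc 0 L := fun s hs =>
    ⟨by nlinarith [hs.2], by nlinarith [hs.1]⟩
  have hXo : ∀ s ∈ Ioo 0 S, L + -lam2 * s ∈ Ioo 0 L := fun s hs =>
    ⟨by nlinarith [hs.2], by nlinarith [hs.1]⟩
  have hφ : MapsTo (fun p : ℝ × ℝ => (L + -lam2 * p.1, (L + -lam2 * p.1) * p.2))
      (Icc 0 S ×ˢ Icc 0 1) {p : ℝ × ℝ | 0 ≤ p.2 ∧ p.2 ≤ p.1 ∧ p.1 ≤ L} := fun p hp =>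
    ⟨mul_nonneg (hX _ hp.1).1 hp.2.1, mul_le_of_le_one_right (hX _ hp.1).1 hp.2.2, (hX _ hp.1).2⟩
  have hψ : MapsTo (fun p : ℝ × ℝ => ((L + -lam2 * p.1) * p.2, t₀ + p.1))
      (Icc 0 S ×ˢ Icc 0 1) (Icc 0 L ×ˢ Ici 0) := fun p hp =>
    ⟨⟨mul_nonneg (hX _ hp.1).1 hp.2.1,
      (mul_le_of_le_one_right (hX _ hp.1).1 hp.2.2).trans (hX _ hp.1).2⟩,
      add_nonneg ht₀ hp.1.1⟩
  have hφc : ContinuousOn (fun p : ℝ × ℝ => (L + -lam2 * p.1, (L + -lam2 * p.1) * p.2))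
      (Icc 0 S ×ˢ Icc 0 1) := by fun_prop
  have hψc : ContinuousOn (fun p : ℝ × ℝ => ((L + -lam2 * p.1) * p.2, t₀ + p.1))
      (Icc 0 S ×ˢ Icc 0 1) := by fun_prop
  have hTri : ∀ x ξ : ℝ, 0 < ξ → ξ < x → x < L →
      {p : ℝ × ℝ | 0 ≤ p.2 ∧ p.2 ≤ p.1 ∧ p.1 ≤ L} ∈ nhds (x, ξ) := by
    intro x ξ h h' h''
    have hopen : IsOpen {p : ℝ × ℝ | 0 < p.2 ∧ p.2 < p.1 ∧ p.1 < L} :=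
      (isOpen_lt continuous_const continuous_snd).inter
        ((isOpen_lt continuous_snd continuous_fst).inter
          (isOpen_lt continuous_fst continuous_const))
    exact Filter.mem_of_superset (hopen.mem_nhds ⟨h, h', h''⟩)
      fun p hp => ⟨hp.1.le, hp.2.1.le, hp.2.2.le⟩
  let A : ℝ × ℝ → ℝ := fun p => Kw (L + -lam2 * p.1) ((L + -lam2 * p.1) * p.2)
  let B : ℝ × ℝ → ℝ := fun p => Kv (L + -lam2 * p.1) ((L + -lam2 * p.1) * p.2)
  let W : ℝ × ℝ → ℝ := fun p => w ((L + -lam2 * p.1) * p.2) (t₀ + p.1)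
  let V : ℝ × ℝ → ℝ := fun p => v ((L + -lam2 * p.1) * p.2) (t₀ + p.1)
  let P : ℝ × ℝ → ℝ := fun p => (L + -lam2 * p.1) * (A p * W p + B p * V p)
  let Q : ℝ × ℝ → ℝ := fun p =>
    (lam1 + lam2 * p.2) * (A p * W p) - lam2 * (1 - p.2) * (B p * V p)
  have cA : ContinuousOn A (Icc 0 S ×ˢ Icc 0 1) := hKw.continuousOn.comp hφc hφ
  have cB : ContinuousOn B (Icc 0 S ×ˢ Icc 0 1) := hKv.continuousOn.comp hφc hφ
  have cW : ContinuousOn W (Icc 0 S ×ˢ Icc 0 1) := hw.continuousOn.comp hψc hψ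
  have cV : ContinuousOn V (Icc 0 S ×ˢ Icc 0 1) := hv.continuousOn.comp hψc hψ
  have hdiff : ∀ s ∈ Ioo 0 S, ∀ θ ∈ Ioo (0:ℝ) 1,
      DifferentiableAt ℝ (fun p : ℝ × ℝ => Kw p.1 p.2)
        (L + -lam2 * s, (L + -lam2 * s) * θ) ∧
      DifferentiableAt ℝ (fun p : ℝ × ℝ => Kv p.1 p.2)
        (L + -lam2 * s, (L + -lam2 * s) * θ) ∧
      DifferentiableAt ℝ (fun p : ℝ × ℝ => w p.1 p.2) ((L + -lam2 * s) * θ, t₀ + s) ∧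
      DifferentiableAt ℝ (fun p : ℝ × ℝ => v p.1 p.2) ((L + -lam2 * s) * θ, t₀ + s) := by
    intro s hs θ hθ
    have hx := hXo s hs
    have hξ : 0 < (L + -lam2 * s) * θ := mul_pos hx.1 hθ.1
    have hξx : (L + -lam2 * s) * θ < L + -lam2 * s := mul_lt_of_lt_one_right hx.1 hθ.2
    have hn := hTri _ _ hξ hξx hx.2
    have hn' : Icc 0 L ×ˢ Ici 0 ∈ nhds ((L + -lam2 * s) * θ, t₀ + s) :=
      prod_mem_nhds (Icc_mem_nhds hξ (hξx.trans hx.2))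
        (Ici_mem_nhds (add_pos_of_nonneg_of_pos ht₀ hs.1))
    exact ⟨(hKw.contDiffAt hn).differentiableAt (by simp),
      (hKv.contDiffAt hn).differentiableAt (by simp),
      (hw.contDiffAt hn').differentiableAt (by simp),
      (hv.contDiffAt hn').differentiableAt (by simp)⟩
  have hdiffABWV : ∀ s ∈ Ioo 0 S, ∀ θ ∈ Ioo (0:ℝ) 1,
      DifferentiableAt ℝ A (s, θ) ∧ DifferentiableAt ℝ B (s, θ) ∧
      DifferentiableAt ℝ W (s, θ) ∧ DifferentiableAt ℝ V (s, θ) := by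
    intro s hs θ hθ
    obtain ⟨dKw, dKv, dw, dv⟩ := hdiff s hs θ hθ
    have dφ : DifferentiableAt ℝ
        (fun p : ℝ × ℝ => (L + -lam2 * p.1, (L + -lam2 * p.1) * p.2)) (s, θ) := by fun_prop
    have dψ : DifferentiableAt ℝ
        (fun p : ℝ × ℝ => ((L + -lam2 * p.1) * p.2, t₀ + p.1)) (s, θ) := by fun_prop
    exact ⟨dKw.fun_comp' (s, θ) dφ, dKv.fun_comp' (s, θ) dφ,
      dw.fun_comp' (s, θ) dψ, dv.fun_comp' (s, θ) dψ⟩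
  have key := boundary_integral_eq_zero_of_div_eq_zero hS.le zero_le_one P Q
    (by fun_prop) (by fun_prop)
    (fun s hs θ hθ => by
      obtain ⟨dA, dB, dW, dV⟩ := hdiffABWV s hs θ hθ
      fun_prop)
    (fun s hs θ hθ => by
      obtain ⟨dA, dB, dW, dV⟩ := hdiffABWV s hs θ hθ
      fun_prop)
    (fun s hs θ hθ => by
      obtain ⟨dKw, dKv, dw, dv⟩ := hdiff s hs θ hθ
      have hx := hXo s hs
      have hξ : 0 < (L + -lam2 * s) * θ := mul_pos hx.1 hθ.1
      have hξx : (L + -lam2 * s) * θ < L + -lam2 * s := mul_lt_of_lt_one_right hx.1 hθ.2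
      have k1 := hker1 _ _ hξ.le hξx.le hx.2.le
      have k2 := hker2 _ _ hξ.le hξx.le hx.2.le
      have pw := hwpde _ ⟨hξ, hξx.trans hx.2⟩ _ (add_pos_of_nonneg_of_pos ht₀ hs.1)
      have pv := hvpde _ ⟨hξ, hξx.trans hx.2⟩ _ (add_pos_of_nonneg_of_pos ht₀ hs.1)
      have hXs : HasDerivAt (fun z => L + -lam2 * z) (-lam2) s := by
        simpa using ((hasDerivAt_id s).const_mul (-lam2)).const_add L
      have hξs : HasDerivAt (fun z => (L + -lam2 * z) * θ) (-lam2 * θ) s := hXs.mul_const θ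
      have hTs : HasDerivAt (fun z => t₀ + z) 1 s := (hasDerivAt_id s).const_add t₀
      have hXθ : HasDerivAt (fun _ : ℝ => L + -lam2 * s) 0 θ := hasDerivAt_const _ _
      have hξθ : HasDerivAt (fun z => (L + -lam2 * s) * z) (L + -lam2 * s) θ := by
        simpa using (hasDerivAt_id θ).const_mul (L + -lam2 * s)
      have hTθ : HasDerivAt (fun _ : ℝ => t₀ + s) 0 θ := hasDerivAt_const _ _
      have hPs := hXs.mul
        (((hasDerivAt_comp_curve dKw hXs hξs rfl rfl).mul
          (hasDerivAt_comp_curve dw hξs hTs rfl rfl)).add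
        ((hasDerivAt_comp_curve dKv hXs hξs rfl rfl).mul
          (hasDerivAt_comp_curve dv hξs hTs rfl rfl)))
      have hQθ := ((((hasDerivAt_id θ).const_mul lam2).const_add lam1).mul
          ((hasDerivAt_comp_curve dKw hXθ hξθ rfl rfl).mul
          (hasDerivAt_comp_curve dw hξθ hTθ rfl rfl))).sub
        ((((hasDerivAt_id θ).const_sub 1).const_mul lam2).mul
          ((hasDerivAt_comp_curve dKv hXθ hξθ rfl rfl).mul
          (hasDerivAt_comp_curve dv hξθ hTθ rfl rfl)))
      have eP : deriv (fun z => P (z, θ)) s = _ := hPs.deriv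
      have eQ : deriv (fun z => Q (s, z)) θ = _ := hQθ.deriv
      rw [eP, eQ]
      simp only [id, Pi.mul_apply, Pi.add_apply, mul_one]
      generalize L + -lam2 * s = x at *
      linear_combination (-x * w (x * θ) (t₀ + s)) * k1 - lam2 * x * v (x * θ) (t₀ + s) * k2
        + x * Kw x (x * θ) * pw + x * Kv x (x * θ) * pv)
  have hQ1 : ∫ s in (0:ℝ)..S, Q (s, 1)
      = -∫ s in (0:ℝ)..S, c (L + -lam2 * s) * w (L + -lam2 * s) (t₀ + s) := by
    rw [← intervalIntegral.integral_neg]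
    refine intervalIntegral.integral_congr fun s hs => ?_
    rw [uIcc_of_le hS.le] at hs
    have h3 := hker3 _ (hX s hs)
    have : lam1 + lam2 ≠ 0 := by positivity
    simp only [Q, A, W, mul_one, h3]
    field_simp
    ring
  have hQ0 : ∫ s in (0:ℝ)..S, Q (s, 0) = 0 := by
    refine (intervalIntegral.integral_congr (g := fun _ => 0) fun s hs => ?_).trans
      intervalIntegral.integral_zero
    rw [uIcc_of_le hS.le] at hs
    have h4 := hker4 _ (hX s hs)
    have h0 := hbc0 _ (add_nonneg ht₀ hs.1)
    simp only [Q, A, B, W, V, mul_zero, h4, h0]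
    field_simp
    ring
  have hPS : ∫ θ in (0:ℝ)..1, P (S, θ) = 0 := by simp only [P, hSL]; simp
  have hP0 : ∫ θ in (0:ℝ)..1, P (0, θ)
      = ∫ ξ in (0:ℝ)..L, Kw L ξ * w ξ t₀ + Kv L ξ * v ξ t₀ := by
    have := intervalIntegral.mul_integral_comp_mul_left (a := 0) (b := 1) (c := L)
      (f := fun ξ => Kw L ξ * w ξ t₀ + Kv L ξ * v ξ t₀)
    simp only [mul_zero, mul_one] at this
    rw [← this, ← intervalIntegral.integral_const_mul]
    simp [P, A, B, W, V]
  rw [hQ1, hQ0, hPS, hP0] at key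
  linarith

/-- with exact backstepping kernels solving the kernel equations,
the closed-loop linearized ARZ plant under the backstepping control
`U(t) = −κ w̃(L,t) + ∫₀^L K^w(L,ξ) w̃(ξ,t) dξ + ∫₀^L K^v(L,ξ) ṽ(ξ,t) dξ`
converges to zero in finite time `t_f = L/λ₁ + L/λ₂`.
Here `r = λ₂/λ₁`, `c(x) = −(1/τ) e^{−x/(τ v*)}`, `κ = e^{−L/(τ v*)}`, and the
triangular domain is `𝒯 = {(x,ξ) : 0 ≤ ξ ≤ x ≤ L}`. -/
theorem stmt_0 (L lam1 lam2 τ vs : ℝ)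
    (hL : 0 < L) (h1 : 0 < lam1) (h2 : 0 < lam2) (hτ : 0 < τ) (hvs : 0 < vs)
    -- the kernels, C¹ on the triangle 𝒯
    (Kw Kv : ℝ → ℝ → ℝ)
    (hKwC1 : ContDiffOn ℝ 1 (fun p : ℝ × ℝ => Kw p.1 p.2)
      {p : ℝ × ℝ | 0 ≤ p.2 ∧ p.2 ≤ p.1 ∧ p.1 ≤ L})
    (hKvC1 : ContDiffOn ℝ 1 (fun p : ℝ × ℝ => Kv p.1 p.2)
      {p : ℝ × ℝ | 0 ≤ p.2 ∧ p.2 ≤ p.1 ∧ p.1 ≤ L})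
    -- the kernel equations on 𝒯
    (hker1 : ∀ x ξ : ℝ, 0 ≤ ξ → ξ ≤ x → x ≤ L →
      lam2 * deriv (fun y => Kw y ξ) x - lam1 * deriv (fun s => Kw x s) ξ
        = (-(1 / τ) * Real.exp (-ξ / (τ * vs))) * Kv x ξ)
    (hker2 : ∀ x ξ : ℝ, 0 ≤ ξ → ξ ≤ x → x ≤ L →
      deriv (fun y => Kv y ξ) x + deriv (fun s => Kv x s) ξ = 0)
    (hker3 : ∀ x ∈ Icc (0:ℝ) L,
      Kw x x = -(-(1 / τ) * Real.exp (-x / (τ * vs))) / (lam1 + lam2))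
    (hker4 : ∀ x ∈ Icc (0:ℝ) L, Kv x 0 = -Kw x 0)
    -- a C¹ solution (w̃, ṽ) of the plant
    (w v : ℝ → ℝ → ℝ) (U : ℝ → ℝ)
    (hwC1 : ContDiffOn ℝ 1 (fun p : ℝ × ℝ => w p.1 p.2) (Icc 0 L ×ˢ Ici 0))
    (hvC1 : ContDiffOn ℝ 1 (fun p : ℝ × ℝ => v p.1 p.2) (Icc 0 L ×ˢ Ici 0))
    (hwpde : ∀ x ∈ Ioo (0:ℝ) L, ∀ t ∈ Ioi (0:ℝ),
      deriv (fun s => w x s) t + lam1 * deriv (fun y => w y t) x = 0)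
    (hvpde : ∀ x ∈ Ioo (0:ℝ) L, ∀ t ∈ Ioi (0:ℝ),
      deriv (fun s => v x s) t - lam2 * deriv (fun y => v y t) x
        = (-(1 / τ) * Real.exp (-x / (τ * vs))) * w x t)
    (hbc0 : ∀ t : ℝ, 0 ≤ t → w 0 t = -(lam2 / lam1) * v 0 t)
    (hbcL : ∀ t : ℝ, 0 ≤ t →
      v L t = Real.exp (-L / (τ * vs)) * w L t + U t)
    -- the backstepping control input
    (hU : ∀ t : ℝ, 0 ≤ t →
      U t = -Real.exp (-L / (τ * vs)) * w L t
        + (∫ ξ in (0:ℝ)..L, Kw L ξ * w ξ t)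
        + ∫ ξ in (0:ℝ)..L, Kv L ξ * v ξ t) :
    ∀ x ∈ Icc (0:ℝ) L, ∀ t : ℝ, L / lam1 + L / lam2 ≤ t →
      w x t = 0 ∧ v x t = 0 := by
  set c : ℝ → ℝ := fun x => -(1 / τ) * Real.exp (-x / (τ * vs)) with hc
  have hcc : Continuous c := by rw [hc]; fun_prop
  have hcw : ContinuousOn (fun p : ℝ × ℝ => c p.1 * w p.1 p.2) (Icc 0 L ×ˢ Ici 0) :=
    (hcc.comp continuous_fst).continuousOn.mul hwC1.continuousOn
  have hvchar : ∀ x ∈ Icc 0 L, ∀ t, 0 ≤ t →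
      v 0 (t + x / lam2) - v x t
        = ∫ s in (0:ℝ)..x / lam2, c (x + -lam2 * s) * w (x + -lam2 * s) (t + s) := by
    intro x hx t ht
    have hS : x + -lam2 * (x / lam2) = 0 := by field_simp; ring
    have h := transport_along_characteristic (a := -lam2) (x₀ := x) (t₀ := t)
      (S := x / lam2) (f := fun x t => c x * w x t) (div_nonneg hx.1 h2.le) ht hvC1
      (fun x hx t ht => by rw [← hvpde x hx t ht]; ring) hcw
      (fun s hs => ⟨by nlinarith [hs.2], by nlinarith [hs.1, hx.2]⟩)
      (fun s hs => ⟨by nlinarith [hs.2], by nlinarith [hs.1, hx.2]⟩)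
    rwa [hS] at h
  have hwchar : ∀ x ∈ Icc 0 L, ∀ t, 0 ≤ t → w x (t + x / lam1) = w 0 t := by
    intro x hx t ht
    have hS : lam1 * (x / lam1) = x := by field_simp
    have h := transport_along_characteristic (a := lam1) (x₀ := 0) (t₀ := t)
      (S := x / lam1) (f := fun _ _ => 0) (div_nonneg hx.1 h1.le) ht hwC1
      hwpde continuousOn_const
      (fun s hs => ⟨by nlinarith [hs.1], by nlinarith [hs.2, hx.2]⟩)
      (fun s hs => ⟨by nlinarith [hs.1], by nlinarith [hs.2, hx.2]⟩)
    rw [zero_add, hS, intervalIntegral.integral_zero] at h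
    linarith
  have hv0 : ∀ t, L / lam2 ≤ t → v 0 t = 0 := by
    intro t ht
    have ht₀ : 0 ≤ t - L / lam2 := sub_nonneg.2 ht
    have hchar := hvchar L ⟨hL.le, le_rfl⟩ _ ht₀
    have hker := integral_kernel_eq_neg_integral_coupling hL h1 h2 ht₀ (c := c) hKwC1 hKvC1
      hker1 hker2 hker3 hker4 hwC1 hvC1 hwpde hvpde hbc0
    have hφ : MapsTo (fun ξ : ℝ => (L, ξ)) (uIcc 0 L)
        {p : ℝ × ℝ | 0 ≤ p.2 ∧ p.2 ≤ p.1 ∧ p.1 ≤ L} := fun ξ hξ => by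
      rw [uIcc_of_le hL.le] at hξ
      exact ⟨hξ.1, hξ.2, le_rfl⟩
    have hψ : MapsTo (fun ξ : ℝ => (ξ, t - L / lam2)) (uIcc 0 L) (Icc 0 L ×ˢ Ici 0) :=
      fun ξ hξ => by
        rw [uIcc_of_le hL.le] at hξ
        exact ⟨hξ, ht₀⟩
    have hφc : ContinuousOn (fun ξ : ℝ => (L, ξ)) (uIcc 0 L) := by fun_prop
    have hψc : ContinuousOn (fun ξ : ℝ => (ξ, t - L / lam2)) (uIcc 0 L) := by fun_prop
    have hiw : IntervalIntegrable (fun ξ => Kw L ξ * w ξ (t - L / lam2))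
        MeasureTheory.volume 0 L := ContinuousOn.intervalIntegrable
      ((hKwC1.continuousOn.comp hφc hφ).mul (hwC1.continuousOn.comp hψc hψ))
    have hiv : IntervalIntegrable (fun ξ => Kv L ξ * v ξ (t - L / lam2))
        MeasureTheory.volume 0 L := ContinuousOn.intervalIntegrable
      ((hKvC1.continuousOn.comp hφc hφ).mul (hvC1.continuousOn.comp hψc hψ))
    rw [intervalIntegral.integral_add hiw hiv] at hker
    have hb := hbcL _ ht₀
    have hu := hU _ ht₀
    rw [sub_add_cancel] at hchar
    linarith
  have hw0 : ∀ x ∈ Icc 0 L, ∀ t, L / lam1 + L / lam2 ≤ t → w x t = 0 := by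
    intro x hx t ht
    have hxl : x / lam1 ≤ L / lam1 := by gcongr; exact hx.2
    have hpos : 0 < L / lam2 := div_pos hL h2
    have h := hwchar x hx (t - x / lam1) (by linarith)
    rw [sub_add_cancel] at h
    rw [h, hbc0 _ (by linarith), hv0 _ (by linarith), mul_zero]
  intro x hx t ht
  refine ⟨hw0 x hx t ht, ?_⟩
  have hp1 : 0 < L / lam1 := div_pos hL h1
  have hp2 : 0 < L / lam2 := div_pos hL h2
  have hxS : 0 ≤ x / lam2 := div_nonneg hx.1 h2.le
  have hS : lam2 * (x / lam2) = x := by field_simp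
  have h := hvchar x hx t (by linarith)
  have hint : ∫ s in (0:ℝ)..x / lam2, c (x + -lam2 * s) * w (x + -lam2 * s) (t + s) = 0 := by
    refine (intervalIntegral.integral_congr (g := fun _ => 0) fun s hs => ?_).trans
      intervalIntegral.integral_zero
    rw [uIcc_of_le hxS] at hs
    simp only [hw0 (x + -lam2 * s)
      ⟨by nlinarith [hs.2], by nlinarith [hs.1, hx.2]⟩ (t + s) (by linarith [hs.1]), mul_zero]
  rw [hint, hv0 _ (by linarith)] at h
  linarith
end

section
/- For every M > 0 there exists ε₀ > 0 (depending only on λ₁, λ₂, L, τ, v*, M) such that for every ε ∈ [0, ε₀] there exist constants C ≥ 1 and η > 0 with the following property. Let K̂^w, K̂^v ∈ C¹(𝒯) satisfy sup_𝒯 |K̂^w| ≤ M, sup_𝒯 |K̂^v| ≤ M, and suppose the kernel-equation residuals are small: for all (x,ξ) ∈ 𝒯 and x ∈ [0,L], |λ₂ ∂_x K̂^w(x,ξ) − λ₁ ∂_ξ K̂^w(x,ξ) − c(ξ) K̂^v(x,ξ)| ≤ ε, |∂_x K̂^v(x,ξ) + ∂_ξ K̂^v(x,ξ)| ≤ ε,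 |K̂^w(x,x) + c(x)/(λ₁+λ₂)| ≤ ε, and |K̂^v(x,0) + K̂^w(x,0)| ≤ ε. Then every C¹ solution (w̃, ṽ) of the plant with approximated control Û(t) = −κ w̃(L,t) + ∫₀^L K̂^w(L,ξ) w̃(ξ,t) dξ + ∫₀^L K̂^v(L,ξ) ṽ(ξ,t) dξ is exponentially stable in L²: ∫₀^L (w̃(x,t)² + ṽ(x,t)²) dx ≤ C e^{−η t} ∫₀^L (w̃(x,0)² + ṽ(x,0)²) dx for all t ≥ 0. -/
open Set Real

/-- `F` is continuous on the plane and, on `O`, has the partial derivatives `Fx` and `Fy`, which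
are themselves continuous on the whole plane. -/
structure HasC1 (O : Set (ℝ × ℝ)) (F Fx Fy : ℝ × ℝ → ℝ) : Prop where
  cont : Continuous F
  cont_fst : Continuous Fx
  cont_snd : Continuous Fy
  hasFDerivAt : ∀ p ∈ O, HasFDerivAt F
    (Fx p • ContinuousLinearMap.fst ℝ ℝ ℝ + Fy p • ContinuousLinearMap.snd ℝ ℝ ℝ) p

lemma HasC1.comp_hasDerivAt {O : Set (ℝ × ℝ)} {F Fx Fy : ℝ × ℝ → ℝ} (h : HasC1 O F Fx Fy)
    {γ₁ γ₂ : ℝ → ℝ} {a b u : ℝ} (h₁ : HasDerivAt γ₁ a u) (h₂ : HasDerivAt γ₂ b u)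
    (hO : (γ₁ u, γ₂ u) ∈ O) :
    HasDerivAt (fun u => F (γ₁ u, γ₂ u))
      (Fx (γ₁ u, γ₂ u) * a + Fy (γ₁ u, γ₂ u) * b) u := by
  have := (h.hasFDerivAt _ hO).comp_hasDerivAt u (h₁.prodMk h₂)
  simpa [Function.comp_def] using this

/-- A `C¹` function on a closed region with a continuous retraction extends continuously, together
with its partial derivatives, to the plane. -/
lemma exists_hasC1_extension {S O : Set (ℝ × ℝ)} (hS : UniqueDiffOn ℝ S) (hO : IsOpen O)
    (hOS : O ⊆ S) {ρ : ℝ × ℝ → ℝ × ℝ} (hρ : Continuous ρ) (hρS : ∀ p, ρ p ∈ S)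
    (hρid : ∀ p ∈ S, ρ p = p) {f : ℝ → ℝ → ℝ}
    (hf : ContDiffOn ℝ 1 (fun p : ℝ × ℝ => f p.1 p.2) S) :
    ∃ F Fx Fy : ℝ × ℝ → ℝ, HasC1 O F Fx Fy ∧ (∀ x y, (x, y) ∈ S → f x y = F (x, y)) ∧
      (∀ x y, (x, y) ∈ O → deriv (fun u => f u y) x = Fx (x, y)) ∧
      (∀ x y, (x, y) ∈ O → deriv (fun u => f x u) y = Fy (x, y)) := by
  set g : ℝ × ℝ → ℝ := fun p => f p.1 p.2 with hg
  have hD : ContinuousOn (fderivWithin ℝ g S) S := hf.continuousOn_fderivWithin hS le_rfl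
  have hDρ : Continuous fun p => fderivWithin ℝ g S (ρ p) :=
    hD.comp_continuous hρ hρS
  have hder : ∀ p ∈ O, HasFDerivAt g (fderivWithin ℝ g S p) p := fun p hp =>
    ((hf.differentiableOn one_ne_zero p (hOS hp)).hasFDerivWithinAt).hasFDerivAt
      (Filter.mem_of_superset (hO.mem_nhds hp) hOS)
  have hsplit : ∀ A : ℝ × ℝ →L[ℝ] ℝ, A (1, 0) • ContinuousLinearMap.fst ℝ ℝ ℝ +
      A (0, 1) • ContinuousLinearMap.snd ℝ ℝ ℝ = A := by
    intro A
    ext <;> simp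
  have hC : HasC1 O (fun p => g (ρ p)) (fun p => fderivWithin ℝ g S (ρ p) (1, 0))
      (fun p => fderivWithin ℝ g S (ρ p) (0, 1)) := by
    refine ⟨hf.continuousOn.comp_continuous hρ hρS, by fun_prop, by fun_prop, fun p hp => ?_⟩
    rw [hsplit, hρid p (hOS hp)]
    refine (hder p hp).congr_of_eventuallyEq ?_
    filter_upwards [hO.mem_nhds hp] with q hq
    rw [hρid q (hOS hq)]
  refine ⟨_, _, _, hC, fun x y h => ?_, fun x y h => ?_, fun x y h => ?_⟩
  · simp [hρid _ h, hg]
  · have := (hder _ h).comp_hasDerivAt x ((hasDerivAt_id x).prodMk (hasDerivAt_const x y))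
    simpa [hρid _ (hOS h), Function.comp_def, hg] using this.deriv
  · have := (hder _ h).comp_hasDerivAt y ((hasDerivAt_const y x).prodMk (hasDerivAt_id y))
    simpa [hρid _ (hOS h), Function.comp_def, hg] using this.deriv

/-- Differentiation under the integral sign for jointly continuous integrands. -/
lemma hasDerivAt_integral_of_continuous {a b : ℝ} (hab : a ≤ b) {F F' : ℝ × ℝ → ℝ}
    (hF : Continuous F) (hF' : Continuous F') {O : Set ℝ} (hO : IsOpen O)
    (hd : ∀ u ∈ O, ∀ s ∈ Ioo a b, HasDerivAt (fun u => F (u, s)) (F' (u, s)) u)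
    {u : ℝ} (hu : u ∈ O) :
    HasDerivAt (fun u => ∫ s in a..b, F (u, s)) (∫ s in a..b, F' (u, s)) u := by
  obtain ⟨r, hr, hball⟩ := Metric.isOpen_iff.1 hO u hu
  obtain ⟨B, hB⟩ := ((isCompact_closedBall u r).prod
    (isCompact_Icc (a := a) (b := b))).exists_bound_of_continuousOn hF'.continuousOn
  refine (intervalIntegral.hasDerivAt_integral_of_dominated_loc_of_deriv_le
    (F := fun u s => F (u, s)) (F' := fun u s => F' (u, s)) (bound := fun _ => B)
    (s := Metric.ball u r) (Metric.ball_mem_nhds u hr) ?_ ?_ ?_ ?_ ?_ ?_).2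
  · exact Filter.Eventually.of_forall fun x =>
      (by fun_prop : Continuous fun s => F (x, s)).aestronglyMeasurable
  · exact (by fun_prop : Continuous fun s => F (u, s)).intervalIntegrable _ _
  · exact (by fun_prop : Continuous fun s => F' (u, s)).aestronglyMeasurable
  · refine Filter.Eventually.of_forall fun s hs x hx => ?_
    rw [uIoc_of_le hab] at hs
    exact hB (x, s) ⟨Metric.ball_subset_closedBall hx, Ioc_subset_Icc_self hs⟩
  · exact continuous_const.intervalIntegrable _ _
  · have : ∀ᵐ s : ℝ, s ≠ b := by
      simp [MeasureTheory.ae_iff]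
    filter_upwards [this] with s hsb hs x hx
    rw [uIoc_of_le hab] at hs
    exact hd x (hball hx) s ⟨hs.1, lt_of_le_of_ne hs.2 hsb⟩

/-- The Volterra backstepping transform, with the integral rescaled to `[0, 1]`. -/
noncomputable def backstep (Kw Kv W V : ℝ × ℝ → ℝ) (p : ℝ × ℝ) : ℝ :=
  V p - ∫ s in (0:ℝ)..1, p.1 * (Kw (p.1, p.1 * s) * W (p.1 * s, p.2)
    + Kv (p.1, p.1 * s) * V (p.1 * s, p.2))

/-- The spatial derivative of the backstepping transform. -/
noncomputable def backstepDeriv (Kw Kwx Kwy Kv Kvx Kvy W Wx V Vx : ℝ × ℝ → ℝ) (p : ℝ × ℝ) : ℝ :=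
  Vx p - ∫ s in (0:ℝ)..1,
    ((Kw (p.1, p.1 * s) * W (p.1 * s, p.2) + Kv (p.1, p.1 * s) * V (p.1 * s, p.2))
      + p.1 * ((Kwx (p.1, p.1 * s) + s * Kwy (p.1, p.1 * s)) * W (p.1 * s, p.2)
        + Kw (p.1, p.1 * s) * (s * Wx (p.1 * s, p.2))
        + (Kvx (p.1, p.1 * s) + s * Kvy (p.1, p.1 * s)) * V (p.1 * s, p.2)
        + Kv (p.1, p.1 * s) * (s * Vx (p.1 * s, p.2))))

/-- The open triangle `0 < ξ < x < L`. -/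
def openTriangle (L : ℝ) : Set (ℝ × ℝ) := {p | 0 < p.2 ∧ p.2 < p.1 ∧ p.1 < L}

lemma mem_openTriangle {L x s : ℝ} (hx : x ∈ Ioo 0 L) (hs : s ∈ Ioo (0:ℝ) 1) :
    (x, x * s) ∈ openTriangle L :=
  ⟨mul_pos hx.1 hs.1, by simpa using mul_lt_mul_of_pos_left hs.2 hx.1, hx.2⟩

lemma mul_mem_Ioo {L x s : ℝ} (hx : x ∈ Ioo 0 L) (hs : s ∈ Ioo (0:ℝ) 1) : x * s ∈ Ioo 0 L :=
  ⟨mul_pos hx.1 hs.1, (mul_lt_of_lt_one_right hx.1 hs.2).trans hx.2⟩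

lemma continuous_backstep {Kw Kv W V : ℝ × ℝ → ℝ} (hKw : Continuous Kw) (hKv : Continuous Kv)
    (hW : Continuous W) (hV : Continuous V) : Continuous (backstep Kw Kv W V) := by
  refine hV.sub (intervalIntegral.continuous_parametric_intervalIntegral_of_continuous' ?_ _ _)
  simp only [Function.uncurry_def]
  fun_prop

lemma continuous_backstepDeriv {Kw Kwx Kwy Kv Kvx Kvy W Wx V Vx : ℝ × ℝ → ℝ}
    (hKw : Continuous Kw) (hKwx : Continuous Kwx) (hKwy : Continuous Kwy)
    (hKv : Continuous Kv) (hKvx : Continuous Kvx) (hKvy : Continuous Kvy)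
    (hW : Continuous W) (hWx : Continuous Wx) (hV : Continuous V) (hVx : Continuous Vx) :
    Continuous (backstepDeriv Kw Kwx Kwy Kv Kvx Kvy W Wx V Vx) := by
  refine hVx.sub (intervalIntegral.continuous_parametric_intervalIntegral_of_continuous' ?_ _ _)
  simp only [Function.uncurry_def]
  fun_prop

section Transform

variable {L : ℝ} {Kw Kwx Kwy Kv Kvx Kvy W Wx Wt V Vx Vt : ℝ × ℝ → ℝ}

lemma hasDerivAt_backstep_time (hKw : Continuous Kw) (hKv : Continuous Kv)
    (hW : HasC1 (Ioo 0 L ×ˢ Ioi 0) W Wx Wt) (hV : HasC1 (Ioo 0 L ×ˢ Ioi 0) V Vx Vt)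
    {x t : ℝ} (hx : x ∈ Ioo 0 L) (ht : 0 < t) :
    HasDerivAt (fun t => backstep Kw Kv W V (x, t)) (backstep Kw Kv Wt Vt (x, t)) t := by
  have hWc := hW.cont
  have hVc := hV.cont
  have hWtc := hW.cont_snd
  have hVtc := hV.cont_snd
  have key : ∀ {F Fx Ft : ℝ × ℝ → ℝ}, HasC1 (Ioo 0 L ×ˢ Ioi 0) F Fx Ft →
      ∀ y ∈ Ioo 0 L, ∀ u ∈ Ioi (0:ℝ), HasDerivAt (fun u => F (y, u)) (Ft (y, u)) u := by
    intro F Fx Ft hF y hy u hu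
    simpa using hF.comp_hasDerivAt (hasDerivAt_const u y) (hasDerivAt_id u) ⟨hy, hu⟩
  refine (key hV x hx t ht).sub (hasDerivAt_integral_of_continuous zero_le_one
    (F := fun q => x * (Kw (x, x * q.2) * W (x * q.2, q.1) + Kv (x, x * q.2) * V (x * q.2, q.1)))
    (F' := fun q =>
      x * (Kw (x, x * q.2) * Wt (x * q.2, q.1) + Kv (x, x * q.2) * Vt (x * q.2, q.1)))
    (by fun_prop) (by fun_prop) isOpen_Ioi (fun u hu s hs => ?_) ht)
  exact HasDerivAt.const_mul x (((key hW _ (mul_mem_Ioo hx hs) u hu).const_mul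
    (Kw (x, x * s))).fun_add ((key hV _ (mul_mem_Ioo hx hs) u hu).const_mul (Kv (x, x * s))))

lemma hasDerivAt_backstep_space
    (hKw : HasC1 (openTriangle L) Kw Kwx Kwy) (hKv : HasC1 (openTriangle L) Kv Kvx Kvy)
    (hW : HasC1 (Ioo 0 L ×ˢ Ioi 0) W Wx Wt) (hV : HasC1 (Ioo 0 L ×ˢ Ioi 0) V Vx Vt)
    {x t : ℝ} (hx : x ∈ Ioo 0 L) (ht : 0 < t) :
    HasDerivAt (fun x => backstep Kw Kv W V (x, t))
      (backstepDeriv Kw Kwx Kwy Kv Kvx Kvy W Wx V Vx (x, t)) x := by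
  obtain ⟨hWc, hWxc, -, -⟩ := id hW
  obtain ⟨hVc, hVxc, -, -⟩ := id hV
  obtain ⟨hKwc, hKwxc, hKwyc, -⟩ := id hKw
  obtain ⟨hKvc, hKvxc, hKvyc, -⟩ := id hKv
  have hVd : HasDerivAt (fun x => V (x, t)) (Vx (x, t)) x := by
    simpa using hV.comp_hasDerivAt (hasDerivAt_id x) (hasDerivAt_const x t) ⟨hx, ht⟩
  refine hVd.sub (hasDerivAt_integral_of_continuous zero_le_one
    (F := fun q => q.1 * (Kw (q.1, q.1 * q.2) * W (q.1 * q.2, t)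
      + Kv (q.1, q.1 * q.2) * V (q.1 * q.2, t)))
    (F' := fun q => (Kw (q.1, q.1 * q.2) * W (q.1 * q.2, t)
        + Kv (q.1, q.1 * q.2) * V (q.1 * q.2, t))
      + q.1 * ((Kwx (q.1, q.1 * q.2) + q.2 * Kwy (q.1, q.1 * q.2)) * W (q.1 * q.2, t)
        + Kw (q.1, q.1 * q.2) * (q.2 * Wx (q.1 * q.2, t))
        + (Kvx (q.1, q.1 * q.2) + q.2 * Kvy (q.1, q.1 * q.2)) * V (q.1 * q.2, t)
        + Kv (q.1, q.1 * q.2) * (q.2 * Vx (q.1 * q.2, t))))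
    (by fun_prop) (by fun_prop) isOpen_Ioo (fun y hy s hs => ?_) hx)
  have hys : HasDerivAt (fun y : ℝ => y * s) s y := by
    simpa using (hasDerivAt_id y).mul_const s
  have dKw := hKw.comp_hasDerivAt (hasDerivAt_id' y) hys (mem_openTriangle hy hs)
  have dKv := hKv.comp_hasDerivAt (hasDerivAt_id' y) hys (mem_openTriangle hy hs)
  have dW := hW.comp_hasDerivAt hys (hasDerivAt_const y t) ⟨mul_mem_Ioo hy hs, ht⟩
  have dV := hV.comp_hasDerivAt hys (hasDerivAt_const y t) ⟨mul_mem_Ioo hy hs, ht⟩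
  refine ((hasDerivAt_id' y).fun_mul
    ((dKw.fun_mul dW).fun_add (dKv.fun_mul dV))).congr_deriv ?_
  ring

/-- The backstepping transform satisfies the transport equation up to the kernel residuals. -/
lemma backstep_residual {l1 l2 : ℝ} {c : ℝ → ℝ} (hc : Continuous c) (h1 : 0 < l1)
    (hKw : HasC1 (openTriangle L) Kw Kwx Kwy) (hKv : HasC1 (openTriangle L) Kv Kvx Kvy)
    (hW : HasC1 (Ioo 0 L ×ˢ Ioi 0) W Wx Wt) (hV : HasC1 (Ioo 0 L ×ˢ Ioi 0) V Vx Vt)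
    (hWeq : ∀ x ∈ Ioo 0 L, ∀ t > 0, Wt (x, t) + l1 * Wx (x, t) = 0)
    (hVeq : ∀ x ∈ Ioo 0 L, ∀ t > 0, Vt (x, t) - l2 * Vx (x, t) = c x * W (x, t))
    {x t : ℝ} (hx : x ∈ Ioo 0 L) (ht : 0 < t) (hbc : W (0, t) = -(l2 / l1) * V (0, t)) :
    backstep Kw Kv Wt Vt (x, t) - l2 * backstepDeriv Kw Kwx Kwy Kv Kvx Kvy W Wx V Vx (x, t)
      = (c x + (l1 + l2) * Kw (x, x)) * W (x, t) + l2 * (Kv (x, 0) + Kw (x, 0)) * V (0, t)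
        + ∫ s in (0:ℝ)..1, x *
          ((l2 * Kwx (x, x * s) - l1 * Kwy (x, x * s) - c (x * s) * Kv (x, x * s))
              * W (x * s, t)
            + l2 * (Kvx (x, x * s) + Kvy (x, x * s)) * V (x * s, t)) := by
  obtain ⟨hWc, hWxc, hWtc, -⟩ := id hW
  obtain ⟨hVc, hVxc, hVtc, -⟩ := id hV
  obtain ⟨hKwc, hKwxc, hKwyc, -⟩ := id hKw
  obtain ⟨hKvc, hKvxc, hKvyc, -⟩ := id hKv
  set P : ℝ → ℝ := fun s => (l1 + l2 * s) * (Kw (x, x * s) * W (x * s, t))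
    + l2 * (s - 1) * (Kv (x, x * s) * V (x * s, t)) with hP
  set P' : ℝ → ℝ := fun s => l2 * (Kw (x, x * s) * W (x * s, t))
    + (l1 + l2 * s) * (x * (Kwy (x, x * s) * W (x * s, t) + Kw (x, x * s) * Wx (x * s, t)))
    + l2 * (Kv (x, x * s) * V (x * s, t))
    + l2 * (s - 1) * (x * (Kvy (x, x * s) * V (x * s, t) + Kv (x, x * s) * Vx (x * s, t)))
    with hP'
  have hP'c : Continuous P' := by fun_prop
  have hPint : ∫ s in (0:ℝ)..1, P' s = P 1 - P 0 := by
    refine intervalIntegral.integral_eq_sub_of_hasDerivAt_of_le zero_le_one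
      (by fun_prop : Continuous P).continuousOn (fun s hs => ?_) (hP'c.intervalIntegrable _ _)
    have hxs : HasDerivAt (fun s : ℝ => x * s) x s := by
      simpa using (hasDerivAt_id s).const_mul x
    have dKw := hKw.comp_hasDerivAt (hasDerivAt_const s x) hxs (mem_openTriangle hx hs)
    have dKv := hKv.comp_hasDerivAt (hasDerivAt_const s x) hxs (mem_openTriangle hx hs)
    have dW := hW.comp_hasDerivAt hxs (hasDerivAt_const s t) ⟨mul_mem_Ioo hx hs, ht⟩
    have dV := hV.comp_hasDerivAt hxs (hasDerivAt_const s t) ⟨mul_mem_Ioo hx hs, ht⟩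
    have dA : HasDerivAt (fun s : ℝ => l1 + l2 * s) l2 s := by
      simpa using ((hasDerivAt_id s).const_mul l2).const_add l1
    have dB : HasDerivAt (fun s : ℝ => l2 * (s - 1)) l2 s := by
      simpa using ((hasDerivAt_id s).sub_const 1).const_mul l2
    convert (dA.fun_mul (dKw.fun_mul dW)).fun_add (dB.fun_mul (dKv.fun_mul dV)) using 1
    simp only [hP']
    ring
  have hP1 : P 1 = (l1 + l2) * (Kw (x, x) * W (x, t)) := by simp [hP]
  have hP0 : P 0 = l1 * (Kw (x, 0) * W (0, t)) - l2 * (Kv (x, 0) * V (0, t)) := by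
    simp [hP]; ring
  have hI : ∀ {g : ℝ → ℝ}, Continuous g → IntervalIntegrable g MeasureTheory.volume 0 1 :=
    fun hg => hg.intervalIntegrable _ _
  have hcongr : ∫ s in (0:ℝ)..1, x * (Kw (x, x * s) * Wt (x * s, t)
      + Kv (x, x * s) * Vt (x * s, t)) =
      ∫ s in (0:ℝ)..1, x * (Kw (x, x * s) * (-l1 * Wx (x * s, t))
      + Kv (x, x * s) * (l2 * Vx (x * s, t) + c (x * s) * W (x * s, t))) := by
    refine intervalIntegral.integral_congr_Ioo_of_le zero_le_one fun s hs => ?_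
    have e1 := hWeq _ (mul_mem_Ioo hx hs) t ht
    have e2 := hVeq _ (mul_mem_Ioo hx hs) t ht
    have e3 : Wt (x * s, t) = -l1 * Wx (x * s, t) := by linarith
    have e4 : Vt (x * s, t) = l2 * Vx (x * s, t) + c (x * s) * W (x * s, t) := by linarith
    simp only [e3, e4]
  have hsum : (∫ s in (0:ℝ)..1, x *
          ((l2 * Kwx (x, x * s) - l1 * Kwy (x, x * s) - c (x * s) * Kv (x, x * s))
              * W (x * s, t)
            + l2 * (Kvx (x, x * s) + Kvy (x, x * s)) * V (x * s, t)))
      = -(∫ s in (0:ℝ)..1, x * (Kw (x, x * s) * (-l1 * Wx (x * s, t))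
          + Kv (x, x * s) * (l2 * Vx (x * s, t) + c (x * s) * W (x * s, t))))
        + l2 * (∫ s in (0:ℝ)..1,
          ((Kw (x, x * s) * W (x * s, t) + Kv (x, x * s) * V (x * s, t))
            + x * ((Kwx (x, x * s) + s * Kwy (x, x * s)) * W (x * s, t)
              + Kw (x, x * s) * (s * Wx (x * s, t))
              + (Kvx (x, x * s) + s * Kvy (x, x * s)) * V (x * s, t)
              + Kv (x, x * s) * (s * Vx (x * s, t)))))
        - ∫ s in (0:ℝ)..1, P' s := by
    rw [← intervalIntegral.integral_neg, ← intervalIntegral.integral_const_mul,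
      ← intervalIntegral.integral_add (hI (by fun_prop)) (hI (by fun_prop)),
      ← intervalIntegral.integral_sub (hI (by fun_prop)) (hI hP'c)]
    refine intervalIntegral.integral_congr fun s _ => ?_
    simp only [hP']
    ring
  have hVx := hVeq x hx t ht
  have hw0 : l1 * W (0, t) = -l2 * V (0, t) := by rw [hbc]; field_simp
  rw [hsum, hPint, hP1, hP0]
  simp only [backstep, backstepDeriv]
  rw [hcongr]
  linear_combination hVx - Kw (x, 0) * hw0

end Transform

/-- Cauchy–Schwarz for the integral of a continuous function over `[0, L]`. -/
lemma sq_integral_le {L : ℝ} (hL : 0 < L) {g : ℝ → ℝ} (hg : Continuous g) :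
    (∫ x in (0:ℝ)..L, g x) ^ 2 ≤ L * ∫ x in (0:ℝ)..L, g x ^ 2 := by
  set I := ∫ x in (0:ℝ)..L, g x with hI
  have h0 : 0 ≤ ∫ x in (0:ℝ)..L, (L * g x - I) ^ 2 :=
    intervalIntegral.integral_nonneg hL.le fun x _ => sq_nonneg _
  have e : ∫ x in (0:ℝ)..L, (L * g x - I) ^ 2
      = L ^ 2 * (∫ x in (0:ℝ)..L, g x ^ 2) - 2 * L * I * I + L * I ^ 2 := by
    have : ∀ x, (L * g x - I) ^ 2 = L ^ 2 * g x ^ 2 - 2 * L * I * g x + I ^ 2 := fun x => by ring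
    simp_rw [this]
    rw [intervalIntegral.integral_add, intervalIntegral.integral_sub,
      intervalIntegral.integral_const_mul, intervalIntegral.integral_const_mul,
      intervalIntegral.integral_const, ← hI]
    · simp
    all_goals exact Continuous.intervalIntegrable (by fun_prop) _ _
  have : 0 ≤ L * (L * (∫ x in (0:ℝ)..L, g x ^ 2) - I ^ 2) := by rw [e] at h0; linarith
  linarith [nonneg_of_mul_nonneg_right this hL]

lemma abs_integral_scaled_le {A B g h : ℝ → ℝ} (hA : Continuous A) (hB : Continuous B)
    (hg : Continuous g) (hh : Continuous h) {m n x : ℝ} (hx : 0 ≤ x)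
    (hAm : ∀ s ∈ Ioo (0:ℝ) 1, |A s| ≤ m) (hBn : ∀ s ∈ Ioo (0:ℝ) 1, |B s| ≤ n) :
    |∫ s in (0:ℝ)..1, x * (A s * g (x * s) + B s * h (x * s))|
      ≤ m * (∫ ξ in (0:ℝ)..x, |g ξ|) + n * ∫ ξ in (0:ℝ)..x, |h ξ| := by
  have e : ∀ k : ℝ → ℝ, ∫ ξ in (0:ℝ)..x, |k ξ| = x * ∫ s in (0:ℝ)..1, |k (x * s)| := fun k => by
    rw [intervalIntegral.mul_integral_comp_mul_left (f := fun ξ => |k ξ|)]; simp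
  have hI : ∀ {g : ℝ → ℝ}, Continuous g → IntervalIntegrable g MeasureTheory.volume 0 1 :=
    fun hg => hg.intervalIntegrable _ _
  calc _ ≤ ∫ s in (0:ℝ)..1, |x * (A s * g (x * s) + B s * h (x * s))| :=
        intervalIntegral.abs_integral_le_integral_abs zero_le_one
    _ ≤ ∫ s in (0:ℝ)..1, (m * x * |g (x * s)| + n * x * |h (x * s)|) := by
        refine intervalIntegral.integral_mono_on_of_le_Ioo zero_le_one (hI (by fun_prop))
          (hI (by fun_prop)) fun s hs => ?_
        have h1 := mul_le_mul_of_nonneg_right (hAm s hs) (abs_nonneg (g (x * s)))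
        have h2 := mul_le_mul_of_nonneg_right (hBn s hs) (abs_nonneg (h (x * s)))
        have h3 := abs_add_le (A s * g (x * s)) (B s * h (x * s))
        rw [abs_mul (A s), abs_mul (B s)] at h3
        rw [abs_mul, abs_of_nonneg hx]
        nlinarith
    _ = _ := by
        rw [intervalIntegral.integral_add (hI (by fun_prop)) (hI (by fun_prop)),
          intervalIntegral.integral_const_mul, intervalIntegral.integral_const_mul, e g, e h]
        ring

lemma integral_abs_mono {L x : ℝ} (hx : x ∈ Icc 0 L) {g : ℝ → ℝ} (hg : Continuous g) :
    ∫ ξ in (0:ℝ)..x, |g ξ| ≤ ∫ ξ in (0:ℝ)..L, |g ξ| :=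
  intervalIntegral.integral_mono_interval le_rfl hx.1 hx.2
    (Filter.Eventually.of_forall fun _ => abs_nonneg _)
    (hg.abs.intervalIntegrable _ _)

lemma sq_integral_abs_le {L : ℝ} (hL : 0 < L) {g : ℝ → ℝ} (hg : Continuous g) :
    (∫ x in (0:ℝ)..L, |g x|) ^ 2 ≤ L * ∫ x in (0:ℝ)..L, g x ^ 2 := by
  simpa only [sq_abs] using sq_integral_le hL hg.abs

/-- An `L²` Grönwall bound for Volterra integral inequalities. -/
lemma integral_sq_le_of_volterra {L M : ℝ} (hL : 0 < L) {V B W : ℝ → ℝ}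
    (hV : Continuous V) (hB : Continuous B) (hW : Continuous W)
    (h : ∀ x ∈ Icc 0 L,
      |V x| ≤ |B x| + M * (∫ ξ in (0:ℝ)..x, |W ξ|) + M * ∫ ξ in (0:ℝ)..x, |V ξ|) :
    ∫ x in (0:ℝ)..L, V x ^ 2 ≤ Real.exp (3 * M ^ 2 * L * L) *
      (3 * (∫ x in (0:ℝ)..L, B x ^ 2) + 3 * M ^ 2 * L ^ 2 * ∫ x in (0:ℝ)..L, W x ^ 2) := by
  set D := 3 * M ^ 2 * L with hD
  have hD0 : 0 ≤ D := by positivity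
  set IW := ∫ x in (0:ℝ)..L, W x ^ 2 with hIW
  set Y : ℝ → ℝ := fun x => ∫ ξ in (0:ℝ)..x, V ξ ^ 2 with hY
  have hY' : ∀ x, HasDerivAt Y (V x ^ 2) x := fun x =>
    (by fun_prop : Continuous fun x => V x ^ 2).integral_hasStrictDerivAt 0 x |>.hasDerivAt
  have hYc : Continuous Y := continuous_iff_continuousAt.2 fun x => (hY' x).continuousAt
  have hE' : ∀ x, HasDerivAt (fun x => Real.exp (-(D * x))) (Real.exp (-(D * x)) * (-D)) x :=
    fun x => by simpa using (((hasDerivAt_id x).const_mul D).fun_neg).exp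
  have hfund : ∫ x in (0:ℝ)..L, (V x ^ 2 * Real.exp (-(D * x))
      + Y x * (Real.exp (-(D * x)) * (-D))) = Y L * Real.exp (-(D * L)) := by
    rw [intervalIntegral.integral_eq_sub_of_hasDerivAt
      (fun x _ => (hY' x).fun_mul (hE' x)) (Continuous.intervalIntegrable (by fun_prop) _ _)]
    simp [hY]
  have hY0 : ∀ x ∈ Icc 0 L, 0 ≤ Y x := fun x hx =>
    intervalIntegral.integral_nonneg hx.1 fun _ _ => sq_nonneg _
  have hpt : ∀ x ∈ Icc 0 L, V x ^ 2 ≤ 3 * B x ^ 2 + D * IW + D * Y x := by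
    intro x hx
    rcases hx.1.eq_or_lt with h0 | h0
    · subst h0
      have h' := h 0 hx
      simp only [intervalIntegral.integral_same, mul_zero, add_zero] at h'
      have hIW0 : 0 ≤ IW := intervalIntegral.integral_nonneg hL.le fun _ _ => sq_nonneg _
      have := sq_le_sq.2 h'
      have hy : Y 0 = 0 := by simp [hY]
      rw [hy]
      nlinarith [sq_nonneg (B 0), mul_nonneg hD0 hIW0]
    have hw : (∫ ξ in (0:ℝ)..x, |W ξ|) ^ 2 ≤ L * IW := by
      refine le_trans ?_ (sq_integral_abs_le hL hW)
      exact pow_le_pow_left₀ (intervalIntegral.integral_nonneg hx.1 fun _ _ => abs_nonneg _)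
        (integral_abs_mono hx hW) 2
    have hv : (∫ ξ in (0:ℝ)..x, |V ξ|) ^ 2 ≤ L * Y x :=
      (sq_integral_abs_le h0 hV).trans (mul_le_mul_of_nonneg_right hx.2 (hY0 x hx))
    have h' := h x hx
    set p := ∫ ξ in (0:ℝ)..x, |W ξ|
    set q := ∫ ξ in (0:ℝ)..x, |V ξ|
    have hsq : V x ^ 2 ≤ (|B x| + M * p + M * q) ^ 2 := by
      rw [← sq_abs (V x)]
      exact pow_le_pow_left₀ (abs_nonneg _) h' 2
    have hM2 := sq_nonneg M
    have hb := sq_abs (B x)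
    have a1 := mul_le_mul_of_nonneg_left hw hM2
    have a2 := mul_le_mul_of_nonneg_left hv hM2
    nlinarith [sq_nonneg (|B x| - M * p), sq_nonneg (|B x| - M * q), sq_nonneg (M * p - M * q)]
  have hIW0 : 0 ≤ IW := intervalIntegral.integral_nonneg hL.le fun _ _ => sq_nonneg _
  have hle : Y L * Real.exp (-(D * L)) ≤ 3 * (∫ x in (0:ℝ)..L, B x ^ 2) + D * IW * L := by
    rw [← hfund]
    calc _ ≤ ∫ x in (0:ℝ)..L, (3 * B x ^ 2 + D * IW) := by
          refine intervalIntegral.integral_mono_on hL.le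
            (Continuous.intervalIntegrable (by fun_prop) _ _)
            (Continuous.intervalIntegrable (by fun_prop) _ _) fun x hx => ?_
          have e1 : Real.exp (-(D * x)) ≤ 1 := Real.exp_le_one_iff.2 (by
            have := mul_nonneg hD0 hx.1; linarith)
          have e0 := (Real.exp_pos (-(D * x))).le
          have hnn : 0 ≤ 3 * B x ^ 2 + D * IW := by positivity
          have := mul_le_mul_of_nonneg_right (hpt x hx) e0
          nlinarith [mul_le_mul_of_nonneg_right e1 hnn]
      _ = _ := by
          rw [intervalIntegral.integral_add (Continuous.intervalIntegrable (by fun_prop) _ _)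
            (Continuous.intervalIntegrable (by fun_prop) _ _),
            intervalIntegral.integral_const_mul, intervalIntegral.integral_const]
          simp [mul_comm]
  rw [Real.exp_neg, ← div_eq_mul_inv, div_le_iff₀ (Real.exp_pos _)] at hle
  calc _ = Y L := rfl
    _ ≤ _ := hle
    _ = _ := by rw [hD]; ring

/-- The closed loop of the plant with approximate kernels, all data being extended to the plane. -/
structure ClosedLoop (L l1 l2 M ε : ℝ) (c : ℝ → ℝ)
    (Kw Kwx Kwy Kv Kvx Kvy W Wx Wt V Vx Vt : ℝ × ℝ → ℝ) : Prop where
  hL : 0 < L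
  h1 : 0 < l1
  h2 : 0 < l2
  hε : 0 ≤ ε
  hc : Continuous c
  hKw : HasC1 (openTriangle L) Kw Kwx Kwy
  hKv : HasC1 (openTriangle L) Kv Kvx Kvy
  hW : HasC1 (Ioo 0 L ×ˢ Ioi 0) W Wx Wt
  hV : HasC1 (Ioo 0 L ×ˢ Ioi 0) V Vx Vt
  Kw_le : ∀ x ξ, 0 ≤ ξ → ξ ≤ x → x ≤ L → |Kw (x, ξ)| ≤ M
  Kv_le : ∀ x ξ, 0 ≤ ξ → ξ ≤ x → x ≤ L → |Kv (x, ξ)| ≤ M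
  res_w : ∀ p ∈ openTriangle L, |l2 * Kwx p - l1 * Kwy p - c p.2 * Kv p| ≤ ε
  res_v : ∀ p ∈ openTriangle L, |Kvx p + Kvy p| ≤ ε
  res_diag : ∀ x ∈ Ioo 0 L, |Kw (x, x) + c x / (l1 + l2)| ≤ ε
  res_zero : ∀ x ∈ Ioo 0 L, |Kv (x, 0) + Kw (x, 0)| ≤ ε
  w_eq : ∀ x ∈ Ioo 0 L, ∀ t > 0, Wt (x, t) + l1 * Wx (x, t) = 0
  v_eq : ∀ x ∈ Ioo 0 L, ∀ t > 0, Vt (x, t) - l2 * Vx (x, t) = c x * W (x, t)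
  w_zero : ∀ t ≥ 0, W (0, t) = -(l2 / l1) * V (0, t)
  v_L : ∀ t ≥ 0, backstep Kw Kv W V (L, t) = 0

namespace ClosedLoop

variable {L l1 l2 M ε : ℝ} {c : ℝ → ℝ} {Kw Kwx Kwy Kv Kvx Kvy W Wx Wt V Vx Vt : ℝ × ℝ → ℝ}

lemma abs_volterra_le
    (h : ClosedLoop L l1 l2 M ε c Kw Kwx Kwy Kv Kvx Kvy W Wx Wt V Vx Vt)
    (t : ℝ) {x : ℝ} (hx : x ∈ Icc 0 L) :
    |V (x, t) - backstep Kw Kv W V (x, t)|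
      ≤ M * (∫ ξ in (0:ℝ)..x, |W (ξ, t)|) + M * ∫ ξ in (0:ℝ)..x, |V (ξ, t)| := by
  have hKw := h.hKw.cont
  have hKv := h.hKv.cont
  have hW := h.hW.cont
  have hV := h.hV.cont
  have hxs : ∀ s ∈ Ioo (0:ℝ) 1, x * s ≤ x := fun s hs => mul_le_of_le_one_right hx.1 hs.2.le
  have := abs_integral_scaled_le (A := fun s => Kw (x, x * s)) (B := fun s => Kv (x, x * s))
    (g := fun ξ => W (ξ, t)) (h := fun ξ => V (ξ, t)) (by fun_prop) (by fun_prop) (by fun_prop)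
    (by fun_prop) hx.1
    (fun s hs => h.Kw_le x (x * s) (mul_nonneg hx.1 hs.1.le) (hxs s hs) hx.2)
    (fun s hs => h.Kv_le x (x * s) (mul_nonneg hx.1 hs.1.le) (hxs s hs) hx.2)
  simpa only [backstep, sub_sub_cancel] using this

lemma integral_v_sq_le
    (h : ClosedLoop L l1 l2 M ε c Kw Kwx Kwy Kv Kvx Kvy W Wx Wt V Vx Vt) (t : ℝ) :
    ∫ x in (0:ℝ)..L, V (x, t) ^ 2 ≤ Real.exp (3 * M ^ 2 * L * L) * (3 + 3 * M ^ 2 * L ^ 2) *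
      ((∫ x in (0:ℝ)..L, W (x, t) ^ 2) + ∫ x in (0:ℝ)..L, backstep Kw Kv W V (x, t) ^ 2) := by
  have hW := h.hW.cont
  have hV := h.hV.cont
  have hB := continuous_backstep h.hKw.cont h.hKv.cont h.hW.cont h.hV.cont
  have key := integral_sq_le_of_volterra (M := M) h.hL (V := fun x => V (x, t))
    (B := fun x => backstep Kw Kv W V (x, t)) (W := fun x => W (x, t)) (by fun_prop)
    (by fun_prop) (by fun_prop) (fun x hx => by
      have h1 := h.abs_volterra_le t hx
      have h2 := abs_sub_abs_le_abs_sub (V (x, t)) (backstep Kw Kv W V (x, t))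
      linarith)
  have hIW : 0 ≤ ∫ x in (0:ℝ)..L, W (x, t) ^ 2 :=
    intervalIntegral.integral_nonneg h.hL.le fun _ _ => sq_nonneg _
  have hIB : 0 ≤ ∫ x in (0:ℝ)..L, backstep Kw Kv W V (x, t) ^ 2 :=
    intervalIntegral.integral_nonneg h.hL.le fun _ _ => sq_nonneg _
  refine key.trans ?_
  rw [mul_assoc (Real.exp _)]
  refine mul_le_mul_of_nonneg_left ?_ (Real.exp_pos _).le
  have : 0 ≤ M ^ 2 * L ^ 2 := by positivity
  nlinarith [mul_nonneg this hIB]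

lemma integral_backstep_sq_le
    (h : ClosedLoop L l1 l2 M ε c Kw Kwx Kwy Kv Kvx Kvy W Wx Wt V Vx Vt) (t : ℝ) :
    ∫ x in (0:ℝ)..L, backstep Kw Kv W V (x, t) ^ 2 ≤ (3 + 3 * M ^ 2 * L ^ 2) *
      ((∫ x in (0:ℝ)..L, W (x, t) ^ 2) + ∫ x in (0:ℝ)..L, V (x, t) ^ 2) := by
  have hW := h.hW.cont
  have hV := h.hV.cont
  have hB := continuous_backstep h.hKw.cont h.hKv.cont h.hW.cont h.hV.cont
  set IW := ∫ x in (0:ℝ)..L, W (x, t) ^ 2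
  set IV := ∫ x in (0:ℝ)..L, V (x, t) ^ 2
  have hIW : 0 ≤ IW := intervalIntegral.integral_nonneg h.hL.le fun _ _ => sq_nonneg _
  calc _ ≤ ∫ x in (0:ℝ)..L, (3 * V (x, t) ^ 2 + 3 * M ^ 2 * L * (IW + IV)) := by
        refine intervalIntegral.integral_mono_on h.hL.le
          (Continuous.intervalIntegrable (by fun_prop) _ _)
          (Continuous.intervalIntegrable (by fun_prop) _ _) fun x hx => ?_
        have hb := h.abs_volterra_le t hx
        have hwm := integral_abs_mono hx (g := fun x => W (x, t)) (by fun_prop)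
        have hvm := integral_abs_mono hx (g := fun x => V (x, t)) (by fun_prop)
        have hws := sq_integral_abs_le h.hL (g := fun x => W (x, t)) (by fun_prop)
        have hvs := sq_integral_abs_le h.hL (g := fun x => V (x, t)) (by fun_prop)
        have hM : 0 ≤ M := (abs_nonneg _).trans (h.Kw_le 0 0 le_rfl le_rfl h.hL.le)
        set p := ∫ x in (0:ℝ)..L, |W (x, t)|
        set q := ∫ x in (0:ℝ)..L, |V (x, t)|
        set b := backstep Kw Kv W V (x, t)
        have hb' : |V (x, t) - b| ≤ M * p + M * q := by
          have := mul_le_mul_of_nonneg_left hwm hM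
          have := mul_le_mul_of_nonneg_left hvm hM
          linarith
        have hbb : |b| ≤ |V (x, t)| + M * p + M * q := by
          have := abs_sub_abs_le_abs_sub b (V (x, t))
          rw [abs_sub_comm] at this
          linarith
        have hsq : b ^ 2 ≤ (|V (x, t)| + M * p + M * q) ^ 2 := by
          rw [← sq_abs b]
          exact pow_le_pow_left₀ (abs_nonneg _) hbb 2
        have a1 := mul_le_mul_of_nonneg_left hws (sq_nonneg M)
        have a2 := mul_le_mul_of_nonneg_left hvs (sq_nonneg M)
        have hv2 := sq_abs (V (x, t))
        nlinarith [sq_nonneg (|V (x, t)| - M * p), sq_nonneg (|V (x, t)| - M * q),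
          sq_nonneg (M * p - M * q)]
    _ = 3 * IV + 3 * M ^ 2 * L ^ 2 * (IW + IV) := by
        rw [intervalIntegral.integral_add (Continuous.intervalIntegrable (by fun_prop) _ _)
          (Continuous.intervalIntegrable (by fun_prop) _ _),
          intervalIntegral.integral_const_mul, intervalIntegral.integral_const]
        simp only [sub_zero, smul_eq_mul]
        ring
    _ ≤ _ := by linarith

lemma backstep_zero (t : ℝ) : backstep Kw Kv W V (0, t) = V (0, t) := by simp [backstep]

/-- The defect of the transport equation for the backstepping transform. -/
lemma abs_defect_le (h : ClosedLoop L l1 l2 M ε c Kw Kwx Kwy Kv Kvx Kvy W Wx Wt V Vx Vt)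
    {x t : ℝ} (hx : x ∈ Ioo 0 L) (ht : 0 < t) :
    |backstep Kw Kv Wt Vt (x, t) - l2 * backstepDeriv Kw Kwx Kwy Kv Kvx Kvy W Wx V Vx (x, t)|
      ≤ ε * ((l1 + l2) * |W (x, t)| + l2 * |V (0, t)| + (∫ ξ in (0:ℝ)..L, |W (ξ, t)|)
        + l2 * ∫ ξ in (0:ℝ)..L, |V (ξ, t)|) := by
  obtain ⟨hWc, -, -, -⟩ := id h.hW
  obtain ⟨hVc, -, -, -⟩ := id h.hV
  obtain ⟨hKwc, hKwxc, hKwyc, -⟩ := id h.hKw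
  obtain ⟨hKvc, hKvxc, hKvyc, -⟩ := id h.hKv
  have hc := h.hc
  have h1 := h.h1
  have h2 := h.h2
  have hε := h.hε
  have hx' : x ∈ Icc 0 L := Ioo_subset_Icc_self hx
  rw [backstep_residual h.hc h.h1 h.hKw h.hKv h.hW h.hV h.w_eq h.v_eq hx ht (h.w_zero t ht.le)]
  have hI := abs_integral_scaled_le
    (A := fun s => l2 * Kwx (x, x * s) - l1 * Kwy (x, x * s) - c (x * s) * Kv (x, x * s))
    (B := fun s => l2 * (Kvx (x, x * s) + Kvy (x, x * s)))
    (g := fun ξ => W (ξ, t)) (h := fun ξ => V (ξ, t)) (m := ε) (n := l2 * ε)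
    (by fun_prop) (by fun_prop) (by fun_prop) (by fun_prop) hx.1.le
    (fun s hs => h.res_w _ (mem_openTriangle hx hs))
    (fun s hs => by
      rw [abs_mul, abs_of_pos h.h2]
      exact mul_le_mul_of_nonneg_left (h.res_v _ (mem_openTriangle hx hs)) h.h2.le)
  have hwm := mul_le_mul_of_nonneg_left
    (integral_abs_mono hx' (g := fun x => W (x, t)) (by fun_prop)) hε
  have hvm := mul_le_mul_of_nonneg_left
    (integral_abs_mono hx' (g := fun x => V (x, t)) (by fun_prop)) (mul_nonneg h2.le hε)
  have hA : |(c x + (l1 + l2) * Kw (x, x)) * W (x, t)| ≤ (l1 + l2) * ε * |W (x, t)| := by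
    have e : c x + (l1 + l2) * Kw (x, x) = (l1 + l2) * (Kw (x, x) + c x / (l1 + l2)) := by
      field_simp
      ring
    rw [e, abs_mul, abs_mul, abs_of_pos (add_pos h1 h2)]
    gcongr
    exact h.res_diag x hx
  have hB : |l2 * (Kv (x, 0) + Kw (x, 0)) * V (0, t)| ≤ l2 * ε * |V (0, t)| := by
    rw [abs_mul, abs_mul, abs_of_pos h2]
    gcongr
    exact h.res_zero x hx
  refine (abs_add_three _ _ _).trans ?_
  linarith

/-- The Lyapunov functional. -/
noncomputable def energy (L l1 l2 a : ℝ) (Kw Kv W V : ℝ × ℝ → ℝ) (t : ℝ) : ℝ :=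
  ∫ x in (0:ℝ)..L, (a * (L + 1 - x) * W (x, t) ^ 2 / l1
    + (1 + x) * backstep Kw Kv W V (x, t) ^ 2 / l2)

lemma hasDerivAt_energy
    (h : ClosedLoop L l1 l2 M ε c Kw Kwx Kwy Kv Kvx Kvy W Wx Wt V Vx Vt) (a : ℝ) {t : ℝ}
    (ht : 0 < t) :
    HasDerivAt (energy L l1 l2 a Kw Kv W V)
      (∫ x in (0:ℝ)..L, (a * (L + 1 - x) * (2 * W (x, t) * Wt (x, t)) / l1
        + (1 + x) * (2 * backstep Kw Kv W V (x, t) * backstep Kw Kv Wt Vt (x, t)) / l2)) t := by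
  obtain ⟨hWc, -, hWtc, -⟩ := id h.hW
  obtain ⟨hVc, -, hVtc, -⟩ := id h.hV
  have hB := continuous_backstep h.hKw.cont h.hKv.cont hWc hVc
  have hBt := continuous_backstep h.hKw.cont h.hKv.cont hWtc hVtc
  refine hasDerivAt_integral_of_continuous h.hL.le
    (F := fun q => a * (L + 1 - q.2) * W (q.2, q.1) ^ 2 / l1
      + (1 + q.2) * backstep Kw Kv W V (q.2, q.1) ^ 2 / l2)
    (F' := fun q => a * (L + 1 - q.2) * (2 * W (q.2, q.1) * Wt (q.2, q.1)) / l1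
      + (1 + q.2) * (2 * backstep Kw Kv W V (q.2, q.1) * backstep Kw Kv Wt Vt (q.2, q.1)) / l2)
    (by fun_prop) (by fun_prop) isOpen_Ioi (fun u hu x hx => ?_) ht
  have dW := h.hW.comp_hasDerivAt (hasDerivAt_const u x) (hasDerivAt_id' u) ⟨hx, hu⟩
  have dB := hasDerivAt_backstep_time h.hKw.cont h.hKv.cont h.hW h.hV hx hu
  refine ((((dW.fun_pow 2).const_mul (a * (L + 1 - x))).div_const l1).fun_add
    (((dB.fun_pow 2).const_mul (1 + x)).div_const l2)).congr_deriv ?_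
  push_cast
  ring

/-- The energy balance, obtained by integrating by parts in space. -/
lemma energy_balance
    (h : ClosedLoop L l1 l2 M ε c Kw Kwx Kwy Kv Kvx Kvy W Wx Wt V Vx Vt) (a : ℝ) {t : ℝ}
    (ht : 0 < t) :
    (∫ x in (0:ℝ)..L, (a * (L + 1 - x) * (2 * W (x, t) * Wt (x, t)) / l1
        + (1 + x) * (2 * backstep Kw Kv W V (x, t) * backstep Kw Kv Wt Vt (x, t)) / l2))
      = a * ((L + 1) * W (0, t) ^ 2 - W (L, t) ^ 2) - V (0, t) ^ 2
        - a * (∫ x in (0:ℝ)..L, W (x, t) ^ 2)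
        - (∫ x in (0:ℝ)..L, backstep Kw Kv W V (x, t) ^ 2)
        + ∫ x in (0:ℝ)..L, 2 * ((1 + x) / l2) * backstep Kw Kv W V (x, t)
          * (backstep Kw Kv Wt Vt (x, t)
            - l2 * backstepDeriv Kw Kwx Kwy Kv Kvx Kvy W Wx V Vx (x, t)) := by
  obtain ⟨hWc, hWxc, hWtc, -⟩ := id h.hW
  obtain ⟨hVc, hVxc, hVtc, -⟩ := id h.hV
  obtain ⟨hKwc, hKwxc, hKwyc, -⟩ := id h.hKw
  obtain ⟨hKvc, hKvxc, hKvyc, -⟩ := id h.hKv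
  have hB := continuous_backstep hKwc hKvc hWc hVc
  have hBt := continuous_backstep hKwc hKvc hWtc hVtc
  have hBx := continuous_backstepDeriv hKwc hKwxc hKwyc hKvc hKvxc hKvyc hWc hWxc hVc hVxc
  have h0 := backstep_zero (Kw := Kw) (Kv := Kv) (W := W) (V := V) t
  have hLt := h.v_L t ht.le
  have dB : ∀ x ∈ Ioo 0 L, _ := fun x hx => hasDerivAt_backstep_space h.hKw h.hKv h.hW h.hV hx ht
  have hl1 := h.h1.ne'
  have hl2 := h.h2.ne'
  set β := backstep Kw Kv W V
  set βt := backstep Kw Kv Wt Vt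
  set βx := backstepDeriv Kw Kwx Kwy Kv Kvx Kvy W Wx V Vx
  have hI : ∀ {g : ℝ → ℝ}, Continuous g → IntervalIntegrable g MeasureTheory.volume 0 L :=
    fun hg => hg.intervalIntegrable _ _
  have hfund : ∫ x in (0:ℝ)..L, (a * (W (x, t) ^ 2 - (L + 1 - x) * (2 * W (x, t) * Wx (x, t)))
      + (β (x, t) ^ 2 + (1 + x) * (2 * β (x, t) * βx (x, t))))
      = a * ((L + 1) * W (0, t) ^ 2 - W (L, t) ^ 2) - V (0, t) ^ 2 := by
    rw [intervalIntegral.integral_eq_sub_of_hasDerivAt_of_le h.hL.le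
      (f := fun x => -a * ((L + 1 - x) * W (x, t) ^ 2) + (1 + x) * β (x, t) ^ 2)
      (by fun_prop : Continuous _).continuousOn (fun x hx => ?_) (hI (by fun_prop))]
    · rw [hLt, h0]
      ring
    · have dW := h.hW.comp_hasDerivAt (hasDerivAt_id' x) (hasDerivAt_const x t) ⟨hx, ht⟩
      convert ((((hasDerivAt_id' x).const_sub (L + 1)).fun_mul (dW.fun_pow 2)).const_mul
        (-a)).fun_add (((hasDerivAt_id' x).const_add 1).fun_mul ((dB x hx).fun_pow 2)) using 1
      push_cast
      ring
  rw [← hfund, ← intervalIntegral.integral_const_mul,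
    ← intervalIntegral.integral_sub (hI (by fun_prop)) (hI (by fun_prop)),
    ← intervalIntegral.integral_sub (hI (by fun_prop)) (hI (by fun_prop)),
    ← intervalIntegral.integral_add (hI (by fun_prop)) (hI (by fun_prop))]
  refine intervalIntegral.integral_congr_Ioo_of_le h.hL.le fun x hx => ?_
  have e : Wt (x, t) = -l1 * Wx (x, t) := by linarith [h.w_eq x hx t ht]
  simp only [e]
  field_simp
  ring

/-- The constant in the `L²` bound for the inverse backstepping transform. -/
noncomputable def inverseConst (L M : ℝ) : ℝ :=
  Real.exp (3 * M ^ 2 * L * L) * (3 + 3 * M ^ 2 * L ^ 2)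

lemma inverseConst_nonneg (L M : ℝ) : 0 ≤ inverseConst L M := by
  unfold inverseConst
  positivity

/-- The constant in the `L²` bound for the defect of the transport equation. -/
noncomputable def defectConst (L l1 l2 M : ℝ) : ℝ :=
  4 * ((l1 + l2) ^ 2 + L * l2 ^ 2 + L ^ 2 + l2 ^ 2 * L ^ 2 * inverseConst L M)

lemma integral_defect_sq_le
    (h : ClosedLoop L l1 l2 M ε c Kw Kwx Kwy Kv Kvx Kvy W Wx Wt V Vx Vt) {t : ℝ} (ht : 0 < t) :
    ∫ x in (0:ℝ)..L, (backstep Kw Kv Wt Vt (x, t)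
        - l2 * backstepDeriv Kw Kwx Kwy Kv Kvx Kvy W Wx V Vx (x, t)) ^ 2
      ≤ ε ^ 2 * defectConst L l1 l2 M * (V (0, t) ^ 2 + (∫ x in (0:ℝ)..L, W (x, t) ^ 2)
        + ∫ x in (0:ℝ)..L, backstep Kw Kv W V (x, t) ^ 2) := by
  obtain ⟨hWc, hWxc, hWtc, -⟩ := id h.hW
  obtain ⟨hVc, hVxc, hVtc, -⟩ := id h.hV
  obtain ⟨hKwc, hKwxc, hKwyc, -⟩ := id h.hKw
  obtain ⟨hKvc, hKvxc, hKvyc, -⟩ := id h.hKv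
  have hBt := continuous_backstep hKwc hKvc hWtc hVtc
  have hBx := continuous_backstepDeriv hKwc hKwxc hKwyc hKvc hKvxc hKvyc hWc hWxc hVc hVxc
  have hI : ∀ {g : ℝ → ℝ}, Continuous g → IntervalIntegrable g MeasureTheory.volume 0 L :=
    fun hg => hg.intervalIntegrable _ _
  have hL := h.hL
  have hG := inverseConst_nonneg L M
  have hIV := h.integral_v_sq_le t
  have hws := sq_integral_abs_le hL (g := fun x => W (x, t)) (by fun_prop)
  have hvs := sq_integral_abs_le hL (g := fun x => V (x, t)) (by fun_prop)
  have hdef : ∀ x ∈ Ioo 0 L, _ := fun x hx => h.abs_defect_le hx ht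
  have hIB0 : 0 ≤ ∫ x in (0:ℝ)..L, backstep Kw Kv W V (x, t) ^ 2 :=
    intervalIntegral.integral_nonneg hL.le fun _ _ => sq_nonneg _
  have hIW0 : 0 ≤ ∫ x in (0:ℝ)..L, W (x, t) ^ 2 :=
    intervalIntegral.integral_nonneg hL.le fun _ _ => sq_nonneg _
  rw [← inverseConst] at hIV
  unfold defectConst
  set G := inverseConst L M
  set IW := ∫ x in (0:ℝ)..L, W (x, t) ^ 2 with hIW
  set IV := ∫ x in (0:ℝ)..L, V (x, t) ^ 2
  set IB := ∫ x in (0:ℝ)..L, backstep Kw Kv W V (x, t) ^ 2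
  set p := ∫ x in (0:ℝ)..L, |W (x, t)|
  set q := ∫ x in (0:ℝ)..L, |V (x, t)|
  calc _ ≤ ∫ x in (0:ℝ)..L, (4 * ε ^ 2 * (l1 + l2) ^ 2 * W (x, t) ^ 2
        + 4 * ε ^ 2 * (l2 ^ 2 * V (0, t) ^ 2 + p ^ 2 + l2 ^ 2 * q ^ 2)) := by
        refine intervalIntegral.integral_mono_on_of_le_Ioo hL.le
          (hI (by fun_prop)) (hI (by fun_prop)) fun x hx => ?_
        have hsq := pow_le_pow_left₀ (abs_nonneg _) (hdef x hx) 2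
        rw [sq_abs, mul_pow] at hsq
        refine hsq.trans ?_
        have e1 := sq_abs (W (x, t))
        have e2 := sq_abs (V (0, t))
        rw [← e1, ← e2]
        have h4 : ∀ y₁ y₂ y₃ y₄ : ℝ, (y₁ + y₂ + y₃ + y₄) ^ 2
            ≤ 4 * (y₁ ^ 2 + y₂ ^ 2 + y₃ ^ 2 + y₄ ^ 2) := fun y₁ y₂ y₃ y₄ => by
          nlinarith [sq_nonneg (y₁ - y₂), sq_nonneg (y₁ - y₃), sq_nonneg (y₁ - y₄),
            sq_nonneg (y₂ - y₃), sq_nonneg (y₂ - y₄), sq_nonneg (y₃ - y₄)]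
        refine (mul_le_mul_of_nonneg_left (h4 _ _ _ _) (sq_nonneg ε)).trans (le_of_eq ?_)
        ring
    _ = ε ^ 2 * (4 * ((l1 + l2) ^ 2 * IW
          + L * (l2 ^ 2 * V (0, t) ^ 2 + p ^ 2 + l2 ^ 2 * q ^ 2))) := by
        rw [intervalIntegral.integral_add (hI (by fun_prop)) (hI (by fun_prop)),
          intervalIntegral.integral_const_mul, intervalIntegral.integral_const]
        simp only [sub_zero, smul_eq_mul, ← hIW]
        ring
    _ ≤ _ := by
        rw [mul_assoc (ε ^ 2)]
        refine mul_le_mul_of_nonneg_left ?_ (sq_nonneg ε)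
        have hq : q ^ 2 ≤ L * (G * (IW + IB)) :=
          hvs.trans (mul_le_mul_of_nonneg_left hIV hL.le)
        calc _ ≤ 4 * ((l1 + l2) ^ 2 * IW
          + L * (l2 ^ 2 * V (0, t) ^ 2 + L * IW + l2 ^ 2 * (L * (G * (IW + IB))))) := by gcongr
          _ = 4 * ((l1 + l2) ^ 2 * IW + L * l2 ^ 2 * V (0, t) ^ 2 + L ^ 2 * IW
              + l2 ^ 2 * L ^ 2 * G * (IW + IB)) := by ring
          _ ≤ 4 * ((l1 + l2) ^ 2 * (V (0, t) ^ 2 + IW + IB)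
              + L * l2 ^ 2 * (V (0, t) ^ 2 + IW + IB) + L ^ 2 * (V (0, t) ^ 2 + IW + IB)
              + l2 ^ 2 * L ^ 2 * G * (V (0, t) ^ 2 + IW + IB)) := by
            have := sq_nonneg (V (0, t))
            gcongr <;> linarith
          _ = _ := by ring

lemma energy_deriv_le
    (h : ClosedLoop L l1 l2 M ε c Kw Kwx Kwy Kv Kvx Kvy W Wx Wt V Vx Vt) {a : ℝ} (ha : 0 < a)
    (har : a * (L + 1) * (l2 / l1) ^ 2 = 1 / 2)
    (hε4 : ε ^ 2 * (2 * ((1 + L) / l2) ^ 2 * defectConst L l1 l2 M) ≤ 1 / 4)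
    (hεa : ε ^ 2 * (2 * ((1 + L) / l2) ^ 2 * defectConst L l1 l2 M) ≤ a / 2)
    {t : ℝ} (ht : 0 < t) :
    (∫ x in (0:ℝ)..L, (a * (L + 1 - x) * (2 * W (x, t) * Wt (x, t)) / l1
        + (1 + x) * (2 * backstep Kw Kv W V (x, t) * backstep Kw Kv Wt Vt (x, t)) / l2))
      ≤ -(a / 2 * ∫ x in (0:ℝ)..L, W (x, t) ^ 2)
        - 1 / 4 * ∫ x in (0:ℝ)..L, backstep Kw Kv W V (x, t) ^ 2 := by
  obtain ⟨hWc, hWxc, hWtc, -⟩ := id h.hW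
  obtain ⟨hVc, hVxc, hVtc, -⟩ := id h.hV
  obtain ⟨hKwc, hKwxc, hKwyc, -⟩ := id h.hKw
  obtain ⟨hKvc, hKvxc, hKvyc, -⟩ := id h.hKv
  have hB := continuous_backstep hKwc hKvc hWc hVc
  have hBt := continuous_backstep hKwc hKvc hWtc hVtc
  have hBx := continuous_backstepDeriv hKwc hKwxc hKwyc hKvc hKvxc hKvyc hWc hWxc hVc hVxc
  have hI : ∀ {g : ℝ → ℝ}, Continuous g → IntervalIntegrable g MeasureTheory.volume 0 L :=
    fun hg => hg.intervalIntegrable _ _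
  have hL := h.hL
  have h2 := h.h2
  rw [h.energy_balance a ht]
  have hdef := h.integral_defect_sq_le ht
  have hw0 := h.w_zero t ht.le
  have hIB0 : 0 ≤ ∫ x in (0:ℝ)..L, backstep Kw Kv W V (x, t) ^ 2 :=
    intervalIntegral.integral_nonneg hL.le fun _ _ => sq_nonneg _
  have hIW0 : 0 ≤ ∫ x in (0:ℝ)..L, W (x, t) ^ 2 :=
    intervalIntegral.integral_nonneg hL.le fun _ _ => sq_nonneg _
  set β := backstep Kw Kv W V
  set f : ℝ → ℝ := fun x => backstep Kw Kv Wt Vt (x, t)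
    - l2 * backstepDeriv Kw Kwx Kwy Kv Kvx Kvy W Wx V Vx (x, t) with hf
  have hfc : Continuous f := by fun_prop
  set IW := ∫ x in (0:ℝ)..L, W (x, t) ^ 2
  set IB := ∫ x in (0:ℝ)..L, β (x, t) ^ 2 with hIB
  have hcross : ∫ x in (0:ℝ)..L, 2 * ((1 + x) / l2) * β (x, t) * f x
      ≤ 1 / 2 * IB + 2 * ((1 + L) / l2) ^ 2 * ∫ x in (0:ℝ)..L, f x ^ 2 := by
    rw [hIB, ← intervalIntegral.integral_const_mul, ← intervalIntegral.integral_const_mul,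
      ← intervalIntegral.integral_add (hI (by fun_prop)) (hI (by fun_prop))]
    refine intervalIntegral.integral_mono_on hL.le (hI (by fun_prop)) (hI (by fun_prop))
      fun x hx => ?_
    have hx0 := hx.1
    have hk : ((1 + x) / l2) ^ 2 ≤ ((1 + L) / l2) ^ 2 := by
      gcongr
      exact hx.2
    have := mul_le_mul_of_nonneg_right hk (sq_nonneg (f x))
    nlinarith [sq_nonneg (β (x, t) - 2 * ((1 + x) / l2) * f x)]
  have hK : 0 ≤ 2 * ((1 + L) / l2) ^ 2 := by positivity
  have hdef' := mul_le_mul_of_nonneg_left hdef hK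
  set N := ε ^ 2 * (2 * ((1 + L) / l2) ^ 2 * defectConst L l1 l2 M) with hN
  have hdef'' : 2 * ((1 + L) / l2) ^ 2 * ∫ x in (0:ℝ)..L, f x ^ 2
      ≤ N * V (0, t) ^ 2 + N * IW + N * IB := by
    refine hdef'.trans (le_of_eq ?_)
    rw [hN]
    ring
  have b1 := mul_le_mul_of_nonneg_right hε4 (sq_nonneg (V (0, t)))
  have b2 := mul_le_mul_of_nonneg_right hεa hIW0
  have b3 := mul_le_mul_of_nonneg_right hε4 hIB0
  have hbd : a * ((L + 1) * W (0, t) ^ 2 - W (L, t) ^ 2) ≤ 1 / 2 * V (0, t) ^ 2 := by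
    have e : a * (L + 1) * W (0, t) ^ 2 = 1 / 2 * V (0, t) ^ 2 := by
      rw [hw0, ← har]
      ring
    have := mul_nonneg ha.le (sq_nonneg (W (L, t)))
    linarith
  have := sq_nonneg (V (0, t))
  linarith

lemma continuous_energy
    (h : ClosedLoop L l1 l2 M ε c Kw Kwx Kwy Kv Kvx Kvy W Wx Wt V Vx Vt) (a : ℝ) :
    Continuous (energy L l1 l2 a Kw Kv W V) := by
  have hW := h.hW.cont
  have hB := continuous_backstep h.hKw.cont h.hKv.cont h.hW.cont h.hV.cont
  refine intervalIntegral.continuous_parametric_intervalIntegral_of_continuous' ?_ _ _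
  simp only [Function.uncurry_def]
  fun_prop

lemma energy_le (h : ClosedLoop L l1 l2 M ε c Kw Kwx Kwy Kv Kvx Kvy W Wx Wt V Vx Vt) {a : ℝ}
    (ha : 0 < a) (t : ℝ) :
    energy L l1 l2 a Kw Kv W V t ≤ a * (L + 1) / l1 * (∫ x in (0:ℝ)..L, W (x, t) ^ 2)
      + (1 + L) / l2 * ∫ x in (0:ℝ)..L, backstep Kw Kv W V (x, t) ^ 2 := by
  have hW := h.hW.cont
  have hB := continuous_backstep h.hKw.cont h.hKv.cont h.hW.cont h.hV.cont
  have hI : ∀ {g : ℝ → ℝ}, Continuous g → IntervalIntegrable g MeasureTheory.volume 0 L :=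
    fun hg => hg.intervalIntegrable _ _
  have h1 := h.h1
  have h2 := h.h2
  rw [← intervalIntegral.integral_const_mul, ← intervalIntegral.integral_const_mul,
    ← intervalIntegral.integral_add (hI (by fun_prop)) (hI (by fun_prop))]
  refine intervalIntegral.integral_mono_on h.hL.le (hI (by fun_prop)) (hI (by fun_prop))
    fun x hx => ?_
  rw [div_mul_eq_mul_div, div_mul_eq_mul_div]
  gcongr
  · linarith [hx.1]
  · exact hx.2

lemma le_energy (h : ClosedLoop L l1 l2 M ε c Kw Kwx Kwy Kv Kvx Kvy W Wx Wt V Vx Vt) {a : ℝ}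
    (ha : 0 < a) (t : ℝ) :
    a / l1 * (∫ x in (0:ℝ)..L, W (x, t) ^ 2)
      + 1 / l2 * (∫ x in (0:ℝ)..L, backstep Kw Kv W V (x, t) ^ 2)
      ≤ energy L l1 l2 a Kw Kv W V t := by
  have hW := h.hW.cont
  have hB := continuous_backstep h.hKw.cont h.hKv.cont h.hW.cont h.hV.cont
  have hI : ∀ {g : ℝ → ℝ}, Continuous g → IntervalIntegrable g MeasureTheory.volume 0 L :=
    fun hg => hg.intervalIntegrable _ _
  have h1 := h.h1
  have h2 := h.h2
  rw [← intervalIntegral.integral_const_mul, ← intervalIntegral.integral_const_mul,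
    ← intervalIntegral.integral_add (hI (by fun_prop)) (hI (by fun_prop))]
  refine intervalIntegral.integral_mono_on h.hL.le (hI (by fun_prop)) (hI (by fun_prop))
    fun x hx => ?_
  rw [div_mul_eq_mul_div, div_mul_eq_mul_div]
  gcongr
  · exact le_mul_of_one_le_right ha.le (by linarith [hx.2])
  · linarith [hx.1]

lemma energy_decay (h : ClosedLoop L l1 l2 M ε c Kw Kwx Kwy Kv Kvx Kvy W Wx Wt V Vx Vt) {a η : ℝ}
    (ha : 0 < a) (har : a * (L + 1) * (l2 / l1) ^ 2 = 1 / 2)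
    (hε4 : ε ^ 2 * (2 * ((1 + L) / l2) ^ 2 * defectConst L l1 l2 M) ≤ 1 / 4)
    (hεa : ε ^ 2 * (2 * ((1 + L) / l2) ^ 2 * defectConst L l1 l2 M) ≤ a / 2)
    (hη : 0 ≤ η) (hη1 : η * ((L + 1) / l1) ≤ 1 / 2) (hη2 : η * ((1 + L) / l2) ≤ 1 / 4)
    {t : ℝ} (ht : 0 ≤ t) :
    energy L l1 l2 a Kw Kv W V t ≤ Real.exp (-η * t) * energy L l1 l2 a Kw Kv W V 0 := by
  have hE := h.continuous_energy a
  have hanti : AntitoneOn (fun t => Real.exp (η * t) * energy L l1 l2 a Kw Kv W V t) (Ici 0) := by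
    have hd : ∀ t > 0, HasDerivAt (fun t => Real.exp (η * t) * energy L l1 l2 a Kw Kv W V t) _ t :=
      fun t ht => (((hasDerivAt_id t).const_mul η).exp).fun_mul (h.hasDerivAt_energy a ht)
    refine antitoneOn_of_deriv_nonpos (convex_Ici 0) (by fun_prop) (fun u hu => ?_) fun u hu => ?_
    · rw [interior_Ici] at hu
      exact (hd u hu).differentiableAt.differentiableWithinAt
    · rw [interior_Ici] at hu
      rw [(hd u hu).deriv]
      have h1 := h.energy_deriv_le ha har hε4 hεa hu
      have h2 := mul_le_mul_of_nonneg_left (h.energy_le ha u) hη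
      have hIB0 : 0 ≤ ∫ x in (0:ℝ)..L, backstep Kw Kv W V (x, u) ^ 2 :=
        intervalIntegral.integral_nonneg h.hL.le fun _ _ => sq_nonneg _
      have hIW0 : 0 ≤ ∫ x in (0:ℝ)..L, W (x, u) ^ 2 :=
        intervalIntegral.integral_nonneg h.hL.le fun _ _ => sq_nonneg _
      have c1 := mul_le_mul_of_nonneg_right hη1 (mul_nonneg ha.le hIW0)
      have c2 := mul_le_mul_of_nonneg_right hη2 hIB0
      set IW := ∫ x in (0:ℝ)..L, W (x, u) ^ 2
      set IB := ∫ x in (0:ℝ)..L, backstep Kw Kv W V (x, u) ^ 2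
      have c1' : η * (a * (L + 1) / l1 * IW) ≤ a / 2 * IW := by
        calc _ = η * ((L + 1) / l1) * (a * IW) := by ring
          _ ≤ _ := c1
          _ = _ := by ring
      rw [mul_one, mul_assoc, ← mul_add]
      exact mul_nonpos_of_nonneg_of_nonpos (Real.exp_pos _).le (by linarith)
  have := hanti self_mem_Ici ht ht
  simp only [mul_zero, Real.exp_zero, one_mul] at this
  rw [neg_mul, Real.exp_neg, inv_mul_eq_div, le_div_iff₀ (Real.exp_pos _), mul_comm]
  exact this

/-- Exponential decay of the `L²` norm of the closed loop. -/
lemma l2_decay (h : ClosedLoop L l1 l2 M ε c Kw Kwx Kwy Kv Kvx Kvy W Wx Wt V Vx Vt) {a η : ℝ}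
    (ha : 0 < a) (har : a * (L + 1) * (l2 / l1) ^ 2 = 1 / 2)
    (hε4 : ε ^ 2 * (2 * ((1 + L) / l2) ^ 2 * defectConst L l1 l2 M) ≤ 1 / 4)
    (hεa : ε ^ 2 * (2 * ((1 + L) / l2) ^ 2 * defectConst L l1 l2 M) ≤ a / 2)
    (hη : 0 ≤ η) (hη1 : η * ((L + 1) / l1) ≤ 1 / 2) (hη2 : η * ((1 + L) / l2) ≤ 1 / 4)
    {t : ℝ} (ht : 0 ≤ t) :
    ∫ x in (0:ℝ)..L, (W (x, t) ^ 2 + V (x, t) ^ 2) ≤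
      ((1 + inverseConst L M) / min (a / l1) (1 / l2) * (a * (L + 1) / l1 + (1 + L) / l2)
        * (1 + (3 + 3 * M ^ 2 * L ^ 2))) * Real.exp (-η * t)
        * ∫ x in (0:ℝ)..L, (W (x, 0) ^ 2 + V (x, 0) ^ 2) := by
  have hW := h.hW.cont
  have hV := h.hV.cont
  have hL := h.hL
  have h1 := h.h1
  have h2 := h.h2
  have hG := inverseConst_nonneg L M
  have hsplit : ∀ u, ∫ x in (0:ℝ)..L, (W (x, u) ^ 2 + V (x, u) ^ 2)
      = (∫ x in (0:ℝ)..L, W (x, u) ^ 2) + ∫ x in (0:ℝ)..L, V (x, u) ^ 2 := fun u =>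
    intervalIntegral.integral_add (Continuous.intervalIntegrable (by fun_prop) _ _)
      (Continuous.intervalIntegrable (by fun_prop) _ _)
  have hnn : ∀ (g : ℝ × ℝ → ℝ) (u : ℝ), 0 ≤ ∫ x in (0:ℝ)..L, g (x, u) ^ 2 := fun g u =>
    intervalIntegral.integral_nonneg hL.le fun _ _ => sq_nonneg _
  have hIV := h.integral_v_sq_le t
  have hIB := h.integral_backstep_sq_le 0
  have hlow := h.le_energy ha t
  have hup := h.energy_le ha 0
  have hdec := h.energy_decay ha har hε4 hεa hη hη1 hη2 ht
  have hWt := hnn W t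
  have hW0 := hnn W 0
  have hV0 := hnn V 0
  have hBt := hnn (backstep Kw Kv W V) t
  have hB0 := hnn (backstep Kw Kv W V) 0
  rw [hsplit, hsplit]
  rw [← inverseConst] at hIV
  set G := inverseConst L M
  set m := min (a / l1) (1 / l2) with hm
  have hm0 : 0 < m := lt_min (by positivity) (by positivity)
  set IW := ∫ x in (0:ℝ)..L, W (x, t) ^ 2
  set IV := ∫ x in (0:ℝ)..L, V (x, t) ^ 2
  set IB := ∫ x in (0:ℝ)..L, backstep Kw Kv W V (x, t) ^ 2
  set IW0 := ∫ x in (0:ℝ)..L, W (x, 0) ^ 2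
  set IV0 := ∫ x in (0:ℝ)..L, V (x, 0) ^ 2
  set IB0 := ∫ x in (0:ℝ)..L, backstep Kw Kv W V (x, 0) ^ 2
  set H := 3 + 3 * M ^ 2 * L ^ 2
  set k := a * (L + 1) / l1 + (1 + L) / l2 with hk
  have hk1 : 0 ≤ a * (L + 1) / l1 := by positivity
  have hk2 : 0 ≤ (1 + L) / l2 := by positivity
  have s1 : IW + IV ≤ (1 + G) * (IW + IB) := by linarith
  have s2 : m * (IW + IB) ≤ energy L l1 l2 a Kw Kv W V t := by
    have e1 := mul_le_mul_of_nonneg_right (min_le_left (a / l1) (1 / l2)) hWt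
    have e2 := mul_le_mul_of_nonneg_right (min_le_right (a / l1) (1 / l2)) hBt
    rw [← hm] at e1 e2
    linarith
  have s3 : energy L l1 l2 a Kw Kv W V 0 ≤ k * (IW0 + IB0) := by
    have := mul_nonneg hk1 hB0
    have := mul_nonneg hk2 hW0
    rw [hk]
    linarith
  have s4 : IW0 + IB0 ≤ (1 + H) * (IW0 + IV0) := by linarith
  have s5 : IW + IB ≤ energy L l1 l2 a Kw Kv W V t / m := by
    rwa [le_div_iff₀ hm0, mul_comm]
  have hk0 : 0 ≤ k := add_nonneg hk1 hk2
  calc _ ≤ (1 + G) * (IW + IB) := s1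
    _ ≤ (1 + G) * ((Real.exp (-η * t) * (k * ((1 + H) * (IW0 + IV0)))) / m) := by
        refine mul_le_mul_of_nonneg_left (s5.trans ?_) (by linarith)
        refine div_le_div_of_nonneg_right (hdec.trans ?_) hm0.le
        refine mul_le_mul_of_nonneg_left (s3.trans ?_) (Real.exp_pos _).le
        exact mul_le_mul_of_nonneg_left s4 hk0
    _ = _ := by ring

end ClosedLoop

lemma convex_triangle (L : ℝ) : Convex ℝ {p : ℝ × ℝ | 0 ≤ p.2 ∧ p.2 ≤ p.1 ∧ p.1 ≤ L} := by
  rintro ⟨x, y⟩ ⟨hx1, hx2, hx3⟩ ⟨u, v⟩ ⟨hu1, hu2, hu3⟩ a b ha hb hab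
  simp only at hx1 hx2 hx3 hu1 hu2 hu3
  simp only [mem_ofPred_eq, Prod.smul_mk, Prod.mk_add_mk, smul_eq_mul]
  refine ⟨by positivity, by gcongr, ?_⟩
  calc a * x + b * u ≤ a * L + b * L := by gcongr
    _ = L := by rw [← add_mul, hab, one_mul]

lemma isOpen_openTriangle (L : ℝ) : IsOpen (openTriangle L) :=
  (isOpen_lt continuous_const continuous_snd).inter
    ((isOpen_lt continuous_snd continuous_fst).inter (isOpen_lt continuous_fst continuous_const))

lemma openTriangle_subset (L : ℝ) :
    openTriangle L ⊆ {p : ℝ × ℝ | 0 ≤ p.2 ∧ p.2 ≤ p.1 ∧ p.1 ≤ L} :=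
  fun _ hp => ⟨hp.1.le, hp.2.1.le, hp.2.2.le⟩

lemma exists_hasC1_extension_triangle {L : ℝ} (hL : 0 < L) {f : ℝ → ℝ → ℝ}
    (hf : ContDiffOn ℝ 1 (fun p : ℝ × ℝ => f p.1 p.2)
      {p : ℝ × ℝ | 0 ≤ p.2 ∧ p.2 ≤ p.1 ∧ p.1 ≤ L}) :
    ∃ F Fx Fy : ℝ × ℝ → ℝ, HasC1 (openTriangle L) F Fx Fy ∧
      (∀ x y, 0 ≤ y → y ≤ x → x ≤ L → f x y = F (x, y)) ∧
      (∀ x y, (x, y) ∈ openTriangle L → deriv (fun u => f u y) x = Fx (x, y)) ∧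
      (∀ x y, (x, y) ∈ openTriangle L → deriv (fun u => f x u) y = Fy (x, y)) := by
  have hne : (interior {p : ℝ × ℝ | 0 ≤ p.2 ∧ p.2 ≤ p.1 ∧ p.1 ≤ L}).Nonempty :=
    ⟨(L / 2, L / 4), interior_maximal (openTriangle_subset L) (isOpen_openTriangle L)
      ⟨by simp only; linarith, by simp only; linarith, by simp only; linarith⟩⟩
  obtain ⟨F, Fx, Fy, hF, he, hx, hy⟩ := exists_hasC1_extension
    (ρ := fun p => (min L (max 0 p.1), min (min L (max 0 p.1)) (max 0 p.2)))
    (uniqueDiffOn_convex (convex_triangle L) hne) (isOpen_openTriangle L) (openTriangle_subset L)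
    (by fun_prop)
    (fun p => ⟨le_min (le_min hL.le (le_max_left _ _)) (le_max_left _ _), min_le_left _ _,
      min_le_left _ _⟩)
    (by
      rintro ⟨x, y⟩ ⟨h1, h2, h3⟩
      simp only at h1 h2 h3
      simp [h1, h2, h3, h1.trans h2]) hf
  exact ⟨F, Fx, Fy, hF, fun x y h1 h2 h3 => he x y ⟨h1, h2, h3⟩, hx, hy⟩

lemma exists_hasC1_extension_strip {L : ℝ} (hL : 0 < L) {f : ℝ → ℝ → ℝ}
    (hf : ContDiffOn ℝ 1 (fun p : ℝ × ℝ => f p.1 p.2) (Icc 0 L ×ˢ Ici 0)) :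
    ∃ F Fx Fy : ℝ × ℝ → ℝ, HasC1 (Ioo 0 L ×ˢ Ioi 0) F Fx Fy ∧
      (∀ x ∈ Icc 0 L, ∀ t ≥ 0, f x t = F (x, t)) ∧
      (∀ x ∈ Ioo 0 L, ∀ t > 0, deriv (fun u => f u t) x = Fx (x, t)) ∧
      (∀ x ∈ Ioo 0 L, ∀ t > 0, deriv (fun u => f x u) t = Fy (x, t)) := by
  obtain ⟨F, Fx, Fy, hF, he, hx, hy⟩ := exists_hasC1_extension
    (ρ := fun p => (min L (max 0 p.1), max 0 p.2))
    ((uniqueDiffOn_Icc hL).prod (uniqueDiffOn_Ici 0)) (isOpen_Ioo.prod isOpen_Ioi)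
    (prod_mono Ioo_subset_Icc_self Ioi_subset_Ici_self) (by fun_prop)
    (fun p => ⟨⟨le_min hL.le (le_max_left _ _), min_le_left _ _⟩, mem_Ici.2 (le_max_left _ _)⟩)
    (by
      rintro ⟨x, y⟩ ⟨⟨h1, h2⟩, h3⟩
      simp only [mem_Ici] at h1 h2 h3
      simp [h1, h2, h3]) hf
  exact ⟨F, Fx, Fy, hF, fun x h1 t h2 => he x t ⟨h1, h2⟩, fun x h1 t h2 => hx x t ⟨h1, h2⟩,
    fun x h1 t h2 => hy x t ⟨h1, h2⟩⟩

/-- robustness of the backstepping design to kernel approximation.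
For every bound `M > 0` on the approximate kernels there is `ε₀ > 0` such that
for every residual size `ε ∈ [0, ε₀]` there are constants `C ≥ 1`, `η > 0` with:
any C¹ approximate kernels bounded by `M` whose kernel-equation residuals are
bounded by `ε`, plugged into the approximated control `Û`, render every C¹
solution of the plant exponentially stable in `L²`. -/
theorem stmt_1 (L lam1 lam2 τ vs : ℝ)
    (hL : 0 < L) (h1 : 0 < lam1) (h2 : 0 < lam2) (hτ : 0 < τ) (hvs : 0 < vs) :
    ∀ M > (0:ℝ), ∃ ε₀ > (0:ℝ), ∀ ε : ℝ, 0 ≤ ε → ε ≤ ε₀ →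
      ∃ C ≥ (1:ℝ), ∃ η > (0:ℝ),
        ∀ (Khw Khv w v : ℝ → ℝ → ℝ) (U : ℝ → ℝ),
          -- approximate kernels: C¹ on the triangle 𝒯 and bounded by M
          ContDiffOn ℝ 1 (fun p : ℝ × ℝ => Khw p.1 p.2)
            {p : ℝ × ℝ | 0 ≤ p.2 ∧ p.2 ≤ p.1 ∧ p.1 ≤ L} →
          ContDiffOn ℝ 1 (fun p : ℝ × ℝ => Khv p.1 p.2)
            {p : ℝ × ℝ | 0 ≤ p.2 ∧ p.2 ≤ p.1 ∧ p.1 ≤ L} →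
          (∀ x ξ : ℝ, 0 ≤ ξ → ξ ≤ x → x ≤ L → |Khw x ξ| ≤ M) →
          (∀ x ξ : ℝ, 0 ≤ ξ → ξ ≤ x → x ≤ L → |Khv x ξ| ≤ M) →
          -- kernel-equation residuals bounded by ε
          (∀ x ξ : ℝ, 0 ≤ ξ → ξ ≤ x → x ≤ L →
            |lam2 * deriv (fun y => Khw y ξ) x - lam1 * deriv (fun s => Khw x s) ξ
              - (-(1 / τ) * Real.exp (-ξ / (τ * vs))) * Khv x ξ| ≤ ε) →
          (∀ x ξ : ℝ, 0 ≤ ξ → ξ ≤ x → x ≤ L →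
            |deriv (fun y => Khv y ξ) x + deriv (fun s => Khv x s) ξ| ≤ ε) →
          (∀ x ∈ Icc (0:ℝ) L,
            |Khw x x + (-(1 / τ) * Real.exp (-x / (τ * vs))) / (lam1 + lam2)| ≤ ε) →
          (∀ x ∈ Icc (0:ℝ) L, |Khv x 0 + Khw x 0| ≤ ε) →
          -- the plant with the approximated control Û
          ContDiffOn ℝ 1 (fun p : ℝ × ℝ => w p.1 p.2) (Icc 0 L ×ˢ Ici 0) →
          ContDiffOn ℝ 1 (fun p : ℝ × ℝ => v p.1 p.2) (Icc 0 L ×ˢ Ici 0) →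
          (∀ x ∈ Ioo (0:ℝ) L, ∀ t ∈ Ioi (0:ℝ),
            deriv (fun s => w x s) t + lam1 * deriv (fun y => w y t) x = 0) →
          (∀ x ∈ Ioo (0:ℝ) L, ∀ t ∈ Ioi (0:ℝ),
            deriv (fun s => v x s) t - lam2 * deriv (fun y => v y t) x
              = (-(1 / τ) * Real.exp (-x / (τ * vs))) * w x t) →
          (∀ t : ℝ, 0 ≤ t → w 0 t = -(lam2 / lam1) * v 0 t) →
          (∀ t : ℝ, 0 ≤ t →
            v L t = Real.exp (-L / (τ * vs)) * w L t + U t) →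
          (∀ t : ℝ, 0 ≤ t →
            U t = -Real.exp (-L / (τ * vs)) * w L t
              + (∫ ξ in (0:ℝ)..L, Khw L ξ * w ξ t)
              + ∫ ξ in (0:ℝ)..L, Khv L ξ * v ξ t) →
          -- exponential stability in L²
          ∀ t : ℝ, 0 ≤ t →
            (∫ x in (0:ℝ)..L, ((w x t) ^ 2 + (v x t) ^ 2))
              ≤ C * Real.exp (-η * t) * ∫ x in (0:ℝ)..L, ((w x 0) ^ 2 + (v x 0) ^ 2) := by
  intro M hM
  set a := lam1 ^ 2 / (2 * (L + 1) * lam2 ^ 2) with ha_def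
  have ha : 0 < a := by positivity
  have har : a * (L + 1) * (lam2 / lam1) ^ 2 = 1 / 2 := by
    rw [ha_def]
    field_simp
  set Q := 2 * ((1 + L) / lam2) ^ 2 * ClosedLoop.defectConst L lam1 lam2 M with hQ_def
  have hQ : 0 < Q := by
    have := ClosedLoop.inverseConst_nonneg L M
    rw [hQ_def, ClosedLoop.defectConst]
    positivity
  set μ := min (1 / 4) (a / 2) with hμ_def
  have hμ : 0 < μ := lt_min (by norm_num) (by positivity)
  refine ⟨min 1 (μ / Q), lt_min one_pos (by positivity), fun ε hε0 hε => ?_⟩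
  have hεμ : ε ^ 2 * Q ≤ μ := by
    have e1 : ε ≤ 1 := hε.trans (min_le_left _ _)
    have e2 : ε * Q ≤ μ := (le_div_iff₀ hQ).1 (hε.trans (min_le_right _ _))
    nlinarith [mul_nonneg hε0 hQ.le]
  set η := min (lam1 / (2 * (L + 1))) (lam2 / (4 * (1 + L))) with hη_def
  have hη : 0 < η := lt_min (by positivity) (by positivity)
  have hη1 : η * ((L + 1) / lam1) ≤ 1 / 2 := by
    calc _ ≤ lam1 / (2 * (L + 1)) * ((L + 1) / lam1) :=
          mul_le_mul_of_nonneg_right (min_le_left _ _) (by positivity)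
      _ = 1 / 2 := by field_simp
  have hη2 : η * ((1 + L) / lam2) ≤ 1 / 4 := by
    calc _ ≤ lam2 / (4 * (1 + L)) * ((1 + L) / lam2) :=
          mul_le_mul_of_nonneg_right (min_le_right _ _) (by positivity)
      _ = 1 / 4 := by field_simp
  set C := (1 + ClosedLoop.inverseConst L M) / min (a / lam1) (1 / lam2)
    * (a * (L + 1) / lam1 + (1 + L) / lam2) * (1 + (3 + 3 * M ^ 2 * L ^ 2)) with hC
  refine ⟨max 1 C, le_max_left _ _, η, hη, ?_⟩
  intro Khw Khv w v U hKhw hKhv hKwM hKvM hrw hrv hrd hr0 hw hv hweq hveq hw0 hvL hU t ht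
  obtain ⟨Kw, Kwx, Kwy, hKw, eKw, eKwx, eKwy⟩ := exists_hasC1_extension_triangle hL hKhw
  obtain ⟨Kv, Kvx, Kvy, hKv, eKv, eKvx, eKvy⟩ := exists_hasC1_extension_triangle hL hKhv
  obtain ⟨W, Wx, Wt, hW, eW, eWx, eWt⟩ := exists_hasC1_extension_strip hL hw
  obtain ⟨V, Vx, Vt, hV, eV, eVx, eVt⟩ := exists_hasC1_extension_strip hL hv
  have h0L : (0:ℝ) ∈ Icc 0 L := left_mem_Icc.2 hL.le
  have hLL : L ∈ Icc 0 L := right_mem_Icc.2 hL.le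
  have hloop : ClosedLoop L lam1 lam2 M ε (fun x => -(1 / τ) * Real.exp (-x / (τ * vs)))
      Kw Kwx Kwy Kv Kvx Kvy W Wx Wt V Vx Vt :=
    { hL := hL
      h1 := h1
      h2 := h2
      hε := hε0
      hc := by fun_prop
      hKw := hKw
      hKv := hKv
      hW := hW
      hV := hV
      Kw_le := fun x ξ a1 a2 a3 => eKw x ξ a1 a2 a3 ▸ hKwM x ξ a1 a2 a3
      Kv_le := fun x ξ a1 a2 a3 => eKv x ξ a1 a2 a3 ▸ hKvM x ξ a1 a2 a3
      res_w := by
        rintro ⟨x, ξ⟩ hp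
        have hp' := openTriangle_subset L hp
        have := hrw x ξ hp'.1 hp'.2.1 hp'.2.2
        rwa [eKwx x ξ hp, eKwy x ξ hp, eKv x ξ hp'.1 hp'.2.1 hp'.2.2] at this
      res_v := by
        rintro ⟨x, ξ⟩ hp
        have hp' := openTriangle_subset L hp
        have := hrv x ξ hp'.1 hp'.2.1 hp'.2.2
        rwa [eKvx x ξ hp, eKvy x ξ hp] at this
      res_diag := fun x hx => eKw x x hx.1.le le_rfl hx.2.le ▸ hrd x (Ioo_subset_Icc_self hx)
      res_zero := fun x hx => by
        rw [← eKw x 0 le_rfl hx.1.le hx.2.le, ← eKv x 0 le_rfl hx.1.le hx.2.le]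
        exact hr0 x (Ioo_subset_Icc_self hx)
      w_eq := fun x hx t ht => by
        rw [← eWx x hx t ht, ← eWt x hx t ht]
        exact hweq x hx t ht
      v_eq := fun x hx t ht => by
        rw [← eVx x hx t ht, ← eVt x hx t ht, ← eW x (Ioo_subset_Icc_self hx) t (le_of_lt ht)]
        exact hveq x hx t ht
      w_zero := fun t ht => by
        rw [← eW 0 h0L t ht, ← eV 0 h0L t ht]
        exact hw0 t ht
      v_L := fun t ht => by
        have hKwc := hKw.cont
        have hKvc := hKv.cont
        have hWc := hW.cont
        have hVc := hV.cont
        have iw : ∫ ξ in (0:ℝ)..L, Khw L ξ * w ξ t = ∫ ξ in (0:ℝ)..L, Kw (L, ξ) * W (ξ, t) := by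
          refine intervalIntegral.integral_congr fun ξ hξ => ?_
          rw [uIcc_of_le hL.le] at hξ
          simp only [eKw L ξ hξ.1 hξ.2 le_rfl, eW ξ hξ t ht]
        have iv : ∫ ξ in (0:ℝ)..L, Khv L ξ * v ξ t = ∫ ξ in (0:ℝ)..L, Kv (L, ξ) * V (ξ, t) := by
          refine intervalIntegral.integral_congr fun ξ hξ => ?_
          rw [uIcc_of_le hL.le] at hξ
          simp only [eKv L ξ hξ.1 hξ.2 le_rfl, eV ξ hξ t ht]
        have hscale : ∫ s in (0:ℝ)..1, L * (Kw (L, L * s) * W (L * s, t)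
            + Kv (L, L * s) * V (L * s, t))
            = ∫ ξ in (0:ℝ)..L, (Kw (L, ξ) * W (ξ, t) + Kv (L, ξ) * V (ξ, t)) := by
          rw [intervalIntegral.integral_const_mul, intervalIntegral.mul_integral_comp_mul_left
            (f := fun ξ => Kw (L, ξ) * W (ξ, t) + Kv (L, ξ) * V (ξ, t))]
          simp
        rw [backstep, hscale, intervalIntegral.integral_add
          (Continuous.intervalIntegrable (by fun_prop) _ _)
          (Continuous.intervalIntegrable (by fun_prop) _ _), ← iw, ← iv, ← eV L hLL t ht,
          hvL t ht, hU t ht]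
        ring }
  have key := hloop.l2_decay ha har (hεμ.trans (min_le_left _ _)) (hεμ.trans (min_le_right _ _))
    hη.le hη1 hη2 ht
  have hint : ∀ u ≥ 0, ∫ x in (0:ℝ)..L, ((w x u) ^ 2 + (v x u) ^ 2)
      = ∫ x in (0:ℝ)..L, (W (x, u) ^ 2 + V (x, u) ^ 2) := by
    intro u hu
    refine intervalIntegral.integral_congr fun x hx => ?_
    rw [uIcc_of_le hL.le] at hx
    simp only [eW x hx u hu, eV x hx u hu]
  rw [hint t ht, hint 0 le_rfl]
  refine key.trans ?_
  refine mul_le_mul_of_nonneg_right ?_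
    (intervalIntegral.integral_nonneg hL.le fun _ _ => by positivity)
  exact mul_le_mul_of_nonneg_right (le_max_right _ _) (Real.exp_pos _).le
end
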